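/- For every integer n ≥ 1, δ₆(1,1,1,1,1,3; n−1) = −(1/8)·A(n) + (1/8)·A(n/2) + (9/8)·B(n) + (9/8)·B(n/2), where for a positive integer m, A(m) = Σ_{d∣m} χ₋₃(d)·d² and B(m) = Σ_{d∣m} χ₋₃(m/d)·d², and where A(n/2) and B(n/2) are interpreted as 0 when n is odd. -/

import Mathlib

/-- `deltaRep k c n` is the number of `k`-tuples `(x₁, …, x_k)` of nonnegative integers
with `n = Σᵢ cᵢ · xᵢ(xᵢ+1)/2`. -/
noncomputable def deltaRep (k : ℕ) (c : Fin k → ℕ) (n : ℕ) : ℕ :=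
  Set.ncard {x : Fin k → ℕ | n = ∑ i, c i * (x i * (x i + 1) / 2)}

/-- `rRep v b n` is the number of `v`-tuples `(y₁, …, y_v)` of integers with
`n = Σᵢ bᵢ · yᵢ²`. -/
noncomputable def rRep (v : ℕ) (b : Fin v → ℕ) (n : ℕ) : ℕ :=
  Set.ncard {y : Fin v → ℤ | (n : ℤ) = ∑ i, (b i : ℤ) * y i ^ 2}

/-- `qRep k c n` is the number of `k`-tuples `(y₁, …, y_k)` of positive odd integers with
`n = Σᵢ cᵢ · yᵢ²`. -/
noncomputable def qRep (k : ℕ) (c : Fin k → ℕ) (n : ℕ) : ℕ :=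
  Set.ncard {y : Fin k → ℕ | (∀ i, 0 < y i ∧ Odd (y i)) ∧ n = ∑ i, c i * y i ^ 2}

/-- `NstRep v k b c n` is the number of pairs of tuples `((y₁, …, y_v), (z₁, …, z_k))`
with the `yᵢ` integers and the `z_j` nonnegative integers such that
`n = Σᵢ bᵢ·yᵢ² + Σⱼ cⱼ·zⱼ(zⱼ+1)/2`. -/
noncomputable def NstRep (v k : ℕ) (b : Fin v → ℕ) (c : Fin k → ℕ) (n : ℕ) : ℕ :=
  Set.ncard {p : (Fin v → ℤ) × (Fin k → ℕ) |
    (n : ℤ) = ∑ i, (b i : ℤ) * p.1 i ^ 2 +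
      ∑ j, (c j : ℤ) * ((p.2 j * (p.2 j + 1) / 2 : ℕ) : ℤ)}

/-- The finite set of pairs `(a, b)` of nonnegative integers with `a + 2b = n`. -/
def convPairs (n : ℕ) : Finset (ℕ × ℕ) :=
  (Finset.range (n + 1) ×ˢ Finset.range (n + 1)).filter fun p => p.1 + 2 * p.2 = n

/-- The quadratic character mod 3: `χ₋₃(m) = 1` if `m ≡ 1 (mod 3)`, `-1` if
`m ≡ 2 (mod 3)`, `0` if `3 ∣ m`. -/
def chiNeg3 (m : ℤ) : ℤ :=
  if m % 3 = 1 then 1 else if m % 3 = 2 then -1 else 0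

open Finset

/-- The positive quadruples `(a, b, x, y)` with `a * x + b * y = N`. -/
def quads (N : ℕ) : Finset (ℕ × ℕ × ℕ × ℕ) :=
  (Icc 1 N ×ˢ Icc 1 N ×ˢ Icc 1 N ×ˢ Icc 1 N).filter
    fun q => q.1 * q.2.2.1 + q.2.1 * q.2.2.2 = N

theorem mem_quads {N a b x y : ℕ} :
    (a, b, x, y) ∈ quads N ↔ 0 < a ∧ 0 < b ∧ 0 < x ∧ 0 < y ∧ a * x + b * y = N := by
  simp only [quads, mem_filter, mem_product, mem_Icc]
  constructor
  · rintro ⟨⟨h1, h2, h3, h4⟩, h⟩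
    exact ⟨h1.1, h2.1, h3.1, h4.1, h⟩
  · rintro ⟨ha, hb, hx, hy, h⟩
    have h1 := Nat.le_mul_of_pos_right a hx
    have h2 := Nat.le_mul_of_pos_right b hy
    have h3 := Nat.le_mul_of_pos_left x ha
    have h4 := Nat.le_mul_of_pos_left y hb
    exact ⟨⟨⟨ha, by omega⟩, ⟨hb, by omega⟩, ⟨hx, by omega⟩, ⟨hy, by omega⟩⟩, h⟩

/-- The sum of `F a b x y` over the positive solutions of `a * x + b * y = N`. -/
def quadSum (N : ℕ) (F : ℤ → ℤ → ℤ → ℤ → ℚ) : ℚ :=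
  ∑ q ∈ quads N, F q.1 q.2.1 q.2.2.1 q.2.2.2

theorem quadSum_congr {N : ℕ} {F G : ℤ → ℤ → ℤ → ℤ → ℚ}
    (h : ∀ a b x y : ℤ, 0 < a → 0 < b → 0 < x → 0 < y → a * x + b * y = N →
      F a b x y = G a b x y) : quadSum N F = quadSum N G := by
  refine sum_congr rfl ?_
  rintro ⟨a, b, x, y⟩ hq
  obtain ⟨ha, hb, hx, hy, e⟩ := mem_quads.1 hq
  exact h a b x y (by exact_mod_cast ha) (by exact_mod_cast hb) (by exact_mod_cast hx)
    (by exact_mod_cast hy) (by exact_mod_cast e)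

theorem quadSum_add (N : ℕ) (F G : ℤ → ℤ → ℤ → ℤ → ℚ) :
    quadSum N (fun a b x y => F a b x y + G a b x y) = quadSum N F + quadSum N G :=
  sum_add_distrib

theorem quadSum_sub (N : ℕ) (F G : ℤ → ℤ → ℤ → ℤ → ℚ) :
    quadSum N (fun a b x y => F a b x y - G a b x y) = quadSum N F - quadSum N G :=
  sum_sub_distrib _ _

theorem quadSum_mul (N : ℕ) (c : ℚ) (F : ℤ → ℤ → ℤ → ℤ → ℚ) :
    quadSum N (fun a b x y => c * F a b x y) = c * quadSum N F :=
  (mul_sum _ _ _).symm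

/-- Change of variables in a sum over part of the solutions. -/
theorem quadSum_transfer {N M : ℕ} (P Q : ℤ → ℤ → ℤ → ℤ → Prop)
    [∀ a b x y, Decidable (P a b x y)] [∀ a b x y, Decidable (Q a b x y)]
    (F G : ℤ → ℤ → ℤ → ℤ → ℚ) (i j : ℤ × ℤ × ℤ × ℤ → ℤ × ℤ × ℤ × ℤ)
    (hi : ∀ a b x y : ℤ, 0 < a → 0 < b → 0 < x → 0 < y → a * x + b * y = N → P a b x y →
      ∀ a' b' x' y', i (a, b, x, y) = (a', b', x', y') →
      (0 < a' ∧ 0 < b' ∧ 0 < x' ∧ 0 < y' ∧ a' * x' + b' * y' = M ∧ Q a' b' x' y') ∧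
        F a b x y = G a' b' x' y' ∧ j (a', b', x', y') = (a, b, x, y))
    (hj : ∀ a b x y : ℤ, 0 < a → 0 < b → 0 < x → 0 < y → a * x + b * y = M → Q a b x y →
      ∀ a' b' x' y', j (a, b, x, y) = (a', b', x', y') →
      (0 < a' ∧ 0 < b' ∧ 0 < x' ∧ 0 < y' ∧ a' * x' + b' * y' = N ∧ P a' b' x' y') ∧
        i (a', b', x', y') = (a, b, x, y)) :
    quadSum N (fun a b x y => if P a b x y then F a b x y else 0) =
      quadSum M (fun a b x y => if Q a b x y then G a b x y else 0) := by
  unfold quadSum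
  rw [← sum_filter, ← sum_filter]
  let up : ℕ × ℕ × ℕ × ℕ → ℤ × ℤ × ℤ × ℤ := fun q => (q.1, q.2.1, q.2.2.1, q.2.2.2)
  let dn : ℤ × ℤ × ℤ × ℤ → ℕ × ℕ × ℕ × ℕ := fun q =>
    (q.1.toNat, q.2.1.toNat, q.2.2.1.toNat, q.2.2.2.toNat)
  have dn_up : ∀ q, dn (up q) = q := by
    rintro ⟨a, b, x, y⟩; simp [up, dn]
  have up_dn : ∀ a b x y : ℤ, 0 < a → 0 < b → 0 < x → 0 < y →
      up (dn (a, b, x, y)) = (a, b, x, y) := by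
    intro a b x y ha hb hx hy
    simp [up, dn, ha.le, hb.le, hx.le, hy.le]
  have key : ∀ (K : ℕ) (R : ℤ → ℤ → ℤ → ℤ → Prop) (a b x y : ℤ),
      0 < a → 0 < b → 0 < x → 0 < y → a * x + b * y = K → R a b x y →
      dn (a, b, x, y) ∈ quads K ∧ R (dn (a, b, x, y)).1 (dn (a, b, x, y)).2.1
        (dn (a, b, x, y)).2.2.1 (dn (a, b, x, y)).2.2.2 := by
    intro K R a b x y ha hb hx hy h hR
    lift a to ℕ using ha.le
    lift b to ℕ using hb.le
    lift x to ℕ using hx.le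
    lift y to ℕ using hy.le
    refine ⟨mem_quads.2 ?_, ?_⟩
    · simp only [Int.toNat_natCast]
      exact ⟨by exact_mod_cast ha, by exact_mod_cast hb, by exact_mod_cast hx,
        by exact_mod_cast hy, by exact_mod_cast h⟩
    · simpa [dn] using hR
  have pos : ∀ (K a b x y : ℕ), (a, b, x, y) ∈ quads K → (0 : ℤ) < a ∧ (0 : ℤ) < b ∧
      (0 : ℤ) < x ∧ (0 : ℤ) < y ∧ (a : ℤ) * x + b * y = K := by
    intro K a b x y h
    obtain ⟨ha, hb, hx, hy, e⟩ := mem_quads.1 h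
    exact ⟨by exact_mod_cast ha, by exact_mod_cast hb, by exact_mod_cast hx,
      by exact_mod_cast hy, by exact_mod_cast e⟩
  refine sum_nbij' (fun q => dn (i (up q))) (fun q => dn (j (up q))) ?_ ?_ ?_ ?_ ?_
  · rintro ⟨a, b, x, y⟩ hq
    obtain ⟨hq, hP⟩ := mem_filter.1 hq
    obtain ⟨ha, hb, hx, hy, e⟩ := pos _ _ _ _ _ hq
    obtain ⟨⟨h1, h2, h3, h4, h5, h6⟩, -, -⟩ := hi a b x y ha hb hx hy e hP _ _ _ _ rfl
    exact mem_filter.2 (key M Q _ _ _ _ h1 h2 h3 h4 h5 h6)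
  · rintro ⟨a, b, x, y⟩ hq
    obtain ⟨hq, hP⟩ := mem_filter.1 hq
    obtain ⟨ha, hb, hx, hy, e⟩ := pos _ _ _ _ _ hq
    obtain ⟨⟨h1, h2, h3, h4, h5, h6⟩, -⟩ := hj a b x y ha hb hx hy e hP _ _ _ _ rfl
    exact mem_filter.2 (key N P _ _ _ _ h1 h2 h3 h4 h5 h6)
  · rintro ⟨a, b, x, y⟩ hq
    obtain ⟨hq, hP⟩ := mem_filter.1 hq
    obtain ⟨ha, hb, hx, hy, e⟩ := pos _ _ _ _ _ hq
    obtain ⟨⟨h1, h2, h3, h4, h5, h6⟩, -, h7⟩ := hi a b x y ha hb hx hy e hP _ _ _ _ rfl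
    have := up_dn _ _ _ _ h1 h2 h3 h4
    change dn (j (up (dn (i (up (a, b, x, y)))))) = _
    erw [this, h7]
    exact dn_up (a, b, x, y)
  · rintro ⟨a, b, x, y⟩ hq
    obtain ⟨hq, hP⟩ := mem_filter.1 hq
    obtain ⟨ha, hb, hx, hy, e⟩ := pos _ _ _ _ _ hq
    obtain ⟨⟨h1, h2, h3, h4, h5, h6⟩, h7⟩ := hj a b x y ha hb hx hy e hP _ _ _ _ rfl
    have := up_dn _ _ _ _ h1 h2 h3 h4
    change dn (i (up (dn (j (up (a, b, x, y)))))) = _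
    erw [this, h7]
    exact dn_up (a, b, x, y)
  · rintro ⟨a, b, x, y⟩ hq
    obtain ⟨hq, hP⟩ := mem_filter.1 hq
    obtain ⟨ha, hb, hx, hy, e⟩ := pos _ _ _ _ _ hq
    obtain ⟨⟨h1, h2, h3, h4, h5, h6⟩, h7, -⟩ := hi a b x y ha hb hx hy e hP _ _ _ _ rfl
    have := up_dn _ _ _ _ h1 h2 h3 h4
    simp only [up, Prod.ext_iff] at this
    obtain ⟨t1, t2, t3, t4⟩ := this
    rw [h7]
    exact (congr (congr (congr (congr rfl t1) t2) t3) t4).symm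

/-- Swapping the two products. -/
theorem quadSum_swap (N : ℕ) (F : ℤ → ℤ → ℤ → ℤ → ℚ) :
    quadSum N (fun a b x y => F b a y x) = quadSum N F := by
  have := quadSum_transfer (N := N) (M := N) (fun _ _ _ _ => True) (fun _ _ _ _ => True)
    (fun a b x y => F b a y x) F (fun q => (q.2.1, q.1, q.2.2.2, q.2.2.1))
    (fun q => (q.2.1, q.1, q.2.2.2, q.2.2.1)) ?_ ?_
  · simpa using this
  all_goals
    intro a b x y ha hb hx hy e _ a' b' x' y' h
    obtain ⟨rfl, rfl, rfl, rfl⟩ : b = a' ∧ a = b' ∧ y = x' ∧ x = y' := by simpa using h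
    exact ⟨⟨hb, ha, hy, hx, by linarith, trivial⟩, by simp⟩

/-- Exchanging the two factors of the second product. -/
theorem quadSum_swap_right (N : ℕ) (F : ℤ → ℤ → ℤ → ℤ → ℚ) :
    quadSum N (fun a b x y => F a y x b) = quadSum N F := by
  have := quadSum_transfer (N := N) (M := N) (fun _ _ _ _ => True) (fun _ _ _ _ => True)
    (fun a b x y => F a y x b) F (fun q => (q.1, q.2.2.2, q.2.2.1, q.2.1))
    (fun q => (q.1, q.2.2.2, q.2.2.1, q.2.1)) ?_ ?_
  · simpa using this
  all_goals
    intro a b x y ha hb hx hy e _ a' b' x' y' h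
    obtain ⟨rfl, rfl, rfl, rfl⟩ : a = a' ∧ y = b' ∧ x = x' ∧ b = y' := by simpa using h
    exact ⟨⟨ha, hy, hx, hb, by linarith, trivial⟩, by simp⟩

/-- Exchanging the two factors of both products. -/
theorem quadSum_transpose (N : ℕ) (F : ℤ → ℤ → ℤ → ℤ → ℚ) :
    quadSum N (fun a b x y => F x y a b) = quadSum N F := by
  have := quadSum_transfer (N := N) (M := N) (fun _ _ _ _ => True) (fun _ _ _ _ => True)
    (fun a b x y => F x y a b) F (fun q => (q.2.2.1, q.2.2.2, q.1, q.2.1))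
    (fun q => (q.2.2.1, q.2.2.2, q.1, q.2.1)) ?_ ?_
  · simpa using this
  all_goals
    intro a b x y ha hb hx hy e _ a' b' x' y' h
    obtain ⟨rfl, rfl, rfl, rfl⟩ : x = a' ∧ y = b' ∧ a = x' ∧ b = y' := by simpa using h
    exact ⟨⟨hx, hy, ha, hb, by linarith, trivial⟩, by simp⟩

/-- The substitution `(a, b, x, y) ↦ (a - b, b, x, x + y)`. -/
theorem quadSum_shear (N : ℕ) (S : ℤ → ℤ → ℤ → ℤ → ℚ) :
    quadSum N (fun a b x y => if b < a then S (a - b) b x (x + y) else 0) =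
      quadSum N (fun a b x y => if x < y then S a b x y else 0) := by
  refine quadSum_transfer (fun a b _ _ => b < a) (fun _ _ x y => x < y)
    (fun a b x y => S (a - b) b x (x + y)) S
    (fun q => (q.1 - q.2.1, q.2.1, q.2.2.1, q.2.2.1 + q.2.2.2))
    (fun q => (q.1 + q.2.1, q.2.1, q.2.2.1, q.2.2.2 - q.2.2.1)) ?_ ?_
  · intro a b x y ha hb hx hy e hp a' b' x' y' h
    obtain ⟨rfl, rfl, rfl, rfl⟩ : a - b = a' ∧ b = b' ∧ x = x' ∧ x + y = y' := by simpa using h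
    exact ⟨⟨by linarith, hb, hx, by linarith, by linarith, by linarith⟩, rfl, by simp⟩
  · intro a b x y ha hb hx hy e hp a' b' x' y' h
    obtain ⟨rfl, rfl, rfl, rfl⟩ : a + b = a' ∧ b = b' ∧ x = x' ∧ y - x = y' := by simpa using h
    exact ⟨⟨by linarith, hb, hx, by linarith, by linarith, by linarith⟩, by simp⟩

theorem quadSum_split_left {N : ℕ} (F : ℤ → ℤ → ℤ → ℤ → ℚ)
    (hF : ∀ a b x y, F b a y x = F a b x y) :
    quadSum N F = quadSum N (fun a b x y => if a = b then F a b x y else 0) +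
      2 * quadSum N (fun a b x y => if b < a then F a b x y else 0) := by
  have h := quadSum_swap N (fun a b x y => if b < a then F a b x y else 0)
  rw [two_mul]
  nth_rewrite 2 [← h]
  rw [← quadSum_add, ← quadSum_add]
  refine quadSum_congr fun a b x y _ _ _ _ _ => ?_
  rcases lt_trichotomy a b with h | h | h
  · simp [h, h.ne, h.not_gt, hF]
  · simp [h]
  · simp [h, h.ne', h.not_gt]

theorem quadSum_split_right {N : ℕ} (F : ℤ → ℤ → ℤ → ℤ → ℚ)
    (hF : ∀ a b x y, F b a y x = F a b x y) :
    quadSum N F = quadSum N (fun a b x y => if x = y then F a b x y else 0) +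
      2 * quadSum N (fun a b x y => if x < y then F a b x y else 0) := by
  have h := quadSum_swap N (fun a b x y => if x < y then F a b x y else 0)
  rw [two_mul]
  nth_rewrite 2 [← h]
  rw [← quadSum_add, ← quadSum_add]
  refine quadSum_congr fun a b x y _ _ _ _ _ => ?_
  rcases lt_trichotomy x y with h | h | h
  · simp [h, h.ne, h.not_gt]
  · simp [h]
  · simp [h, h.ne', h.not_gt, hF]

/-- A Liouville-type identity: if the symmetrization of `Φ` is the difference of a symmetric
function `S` under the shear `(a, b, x, y) ↦ (a - b, b, x, x + y)`, then the sum of `Φ` reduces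
to sums over the diagonals `a = b` and `x = y`. -/
theorem two_mul_quadSum {N : ℕ} (S Φ : ℤ → ℤ → ℤ → ℤ → ℚ)
    (hS : ∀ a b x y, S b a y x = S a b x y)
    (hΦ : ∀ a b x y, S (a - b) b x (x + y) - S a b x y = Φ a b x y + Φ b a y x) :
    2 * quadSum N Φ =
      quadSum N (fun a b x y => if a = b then S 0 b x (x + y) else 0) -
        quadSum N (fun a b x y => if x = y then S a b x y else 0) := by
  set Ψ : ℤ → ℤ → ℤ → ℤ → ℚ := fun a b x y => Φ a b x y + Φ b a y x with hΨ
  have h1 : quadSum N Ψ = 2 * quadSum N Φ := by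
    rw [hΨ, quadSum_add, quadSum_swap, two_mul]
  have h2 := quadSum_split_left (N := N) Ψ (fun a b x y => add_comm _ _)
  have h3 : quadSum N (fun a b x y => if b < a then Ψ a b x y else 0) =
      quadSum N (fun a b x y => if x < y then S a b x y else 0) -
        quadSum N (fun a b x y => if b < a then S a b x y else 0) := by
    rw [← quadSum_shear, ← quadSum_sub]
    refine quadSum_congr fun a b x y _ _ _ _ _ => ?_
    split_ifs
    · rw [hΨ, hΦ]
    · simp
  have h4 : quadSum N (fun a b x y => if a = b then Ψ a b x y else 0) =
      quadSum N (fun a b x y => if a = b then S 0 b x (x + y) else 0) -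
        quadSum N (fun a b x y => if a = b then S a b x y else 0) := by
    rw [← quadSum_sub]
    refine quadSum_congr fun a b x y _ _ _ _ _ => ?_
    split_ifs with h
    · rw [hΨ]; dsimp only; rw [← hΦ, h, sub_self]
    · simp
  have h5 := quadSum_split_left (N := N) S hS
  have h6 := quadSum_split_right (N := N) S hS
  linarith

theorem quadSum_diag_left (N : ℕ) (F : ℤ → ℤ → ℤ → ℤ → ℚ) :
    quadSum N (fun a b x y => if a = b then F a b x y else 0) =
      ∑ d ∈ N.divisors, ∑ x ∈ Ico 1 (N / d),
        F d d x (((N / d : ℕ) : ℤ) - x) := by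
  unfold quadSum
  rw [← sum_filter, sum_sigma']
  refine sum_bij' (fun q _ => ⟨q.1, q.2.2.1⟩) (fun p _ => (p.1, p.1, p.2, N / p.1 - p.2))
    ?_ ?_ ?_ ?_ ?_
  · rintro ⟨a, b, x, y⟩ hq
    obtain ⟨hq, hab⟩ := mem_filter.1 hq
    obtain ⟨ha, hb, hx, hy, e⟩ := mem_quads.1 hq
    obtain rfl : a = b := by exact_mod_cast hab
    have e' : N = a * (x + y) := by rw [← e]; ring
    simp only [mem_sigma, Nat.mem_divisors, mem_Ico]
    rw [e', Nat.mul_div_cancel_left _ ha]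
    exact ⟨⟨dvd_mul_right _ _, by positivity⟩, hx, by omega⟩
  · rintro ⟨d, x⟩ hp
    simp only [mem_sigma, Nat.mem_divisors, mem_Ico] at hp
    obtain ⟨⟨⟨k, rfl⟩, h0⟩, hx, hk⟩ := hp
    have hd : 0 < d := Nat.pos_of_ne_zero (by rintro rfl; simp at h0)
    rw [Nat.mul_div_cancel_left _ hd] at *
    refine mem_filter.2 ⟨mem_quads.2 ⟨hd, hd, hx, Nat.sub_pos_of_lt hk, ?_⟩, rfl⟩
    rw [← mul_add, Nat.add_sub_cancel' hk.le]
  · rintro ⟨a, b, x, y⟩ hq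
    obtain ⟨hq, hab⟩ := mem_filter.1 hq
    obtain ⟨ha, hb, hx, hy, e⟩ := mem_quads.1 hq
    obtain rfl : a = b := by exact_mod_cast hab
    have e' : N = a * (x + y) := by rw [← e]; ring
    simp only [Prod.mk.injEq, true_and]
    rw [e', Nat.mul_div_cancel_left _ ha, Nat.add_sub_cancel_left]
  · rintro ⟨d, x⟩ hp
    rfl
  · rintro ⟨a, b, x, y⟩ hq
    obtain ⟨hq, hab⟩ := mem_filter.1 hq
    obtain ⟨ha, hb, hx, hy, e⟩ := mem_quads.1 hq
    obtain rfl : a = b := by exact_mod_cast hab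
    have e' : N = a * (x + y) := by rw [← e]; ring
    rw [e', Nat.mul_div_cancel_left _ ha]
    simp

theorem quadSum_diag_right (N : ℕ) (F : ℤ → ℤ → ℤ → ℤ → ℚ) :
    quadSum N (fun a b x y => if x = y then F a b x y else 0) =
      ∑ d ∈ N.divisors, ∑ a ∈ Ico 1 (N / d),
        F a (((N / d : ℕ) : ℤ) - a) d d := by
  rw [← quadSum_diag_left N (fun a b x y => F x y a b), ← quadSum_transpose]

/-- The character `chiNeg3` with rational values. -/
def chi (m : ℤ) : ℚ := chiNeg3 m

theorem chi_cases (m : ℤ) :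
    (m % 3 = 0 ∧ chi m = 0) ∨ (m % 3 = 1 ∧ chi m = 1) ∨ (m % 3 = 2 ∧ chi m = -1) := by
  have : m % 3 = 0 ∨ m % 3 = 1 ∨ m % 3 = 2 := by omega
  rcases this with h | h | h <;> simp [chi, chiNeg3, h]

theorem chi_values (m : ℤ) : chi m = 0 ∨ chi m = 1 ∨ chi m = -1 := by
  rcases chi_cases m with h | h | h <;> simp [h.2]

theorem chi_neg (m : ℤ) : chi (-m) = -chi m := by
  rcases chi_cases m with h | h | h <;> rcases chi_cases (-m) with h' | h' | h' <;>
    first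
    | omega
    | simp [h.2, h'.2]

theorem chi_add (m k : ℤ) :
    chi (m + k) = chi m + chi k - 3 / 2 * chi m * chi k * (chi m + chi k) := by
  rcases chi_cases m with h | h | h <;> rcases chi_cases k with h' | h' | h' <;>
    rcases chi_cases (m + k) with h'' | h'' | h'' <;>
    first
    | omega
    | norm_num [h.2, h'.2, h''.2]

theorem chi_sub (m k : ℤ) :
    chi (m - k) = chi m - chi k + 3 / 2 * chi m * chi k * (chi m - chi k) := by
  rw [sub_eq_add_neg, chi_add, chi_neg]; ring

theorem chi_two_mul (m : ℤ) : chi (2 * m) = -chi m := by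
  rw [two_mul, chi_add]
  rcases chi_values m with h | h | h <;> norm_num [h]

theorem chi_zero : chi 0 = 0 := by simp [chi, chiNeg3]

theorem chi_mul (m k : ℤ) : chi (m * k) = chi m * chi k := by
  have e : (m * k) % 3 = (m % 3) * (k % 3) % 3 := Int.mul_emod _ _ _
  rcases chi_cases m with h | h | h <;> rcases chi_cases k with h' | h' | h' <;>
    rw [h.1, h'.1] at e <;> rcases chi_cases (m * k) with h'' | h'' | h'' <;>
    first
    | omega
    | norm_num [h.2, h'.2, h''.2]

/-- Potential on the solutions with all of `a, b, x, y` odd. -/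
def oddPot (a b : ℤ) : ℚ :=
  -1 / 6 * (a * chi a + b * chi b + (a + b) * chi (a + b) + (a - b) * chi (a - b)) -
    1 / 2 * (b * chi a + a * chi b)

/-- Potential on the solutions with `a, y` even and `b, x` odd. -/
def mixPot (a b : ℤ) : ℚ :=
  -1 / 6 * a * chi a + 1 / 2 * a * chi b + 1 / 3 * b * chi b - 1 / 6 * a * chi (a + b) +
    1 / 3 * b * chi (a + b) - 1 / 6 * a * chi (a - b) - 1 / 3 * b * chi (a - b)

/-- The potential for solutions of `a * x + b * y = 2 * n`. -/
def evenPot (a b x y : ℤ) : ℚ :=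
  if Odd x then
    if Odd y then if Odd a ∧ Odd b then oddPot a b else 0
    else if Even a ∧ Odd b then mixPot a b else 0
  else if Odd y ∧ Odd a ∧ Even b then mixPot b a else 0

theorem evenPot_swap (a b x y : ℤ) : evenPot b a y x = evenPot a b x y := by
  have h : oddPot b a = oddPot a b := by
    simp only [oddPot]; rw [← neg_sub a b, chi_neg, add_comm b a]; ring
  unfold evenPot
  simp only [← Int.not_even_iff_odd]
  by_cases hx : Even x <;> by_cases hy : Even y <;> by_cases ha : Even a <;>
    by_cases hb : Even b <;> simp [hx, hy, ha, hb, h, -Int.not_even_iff_odd]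

theorem evenPot_shear (a b x y : ℤ) :
    evenPot (a - b) b x (x + y) - evenPot a b x y =
      ((if Odd a ∧ Odd b ∧ Odd x ∧ Odd y then a * chi b else 0) -
        (if Even a ∧ Odd b ∧ Odd x ∧ Even y then a * chi b else 0)) +
      ((if Odd b ∧ Odd a ∧ Odd y ∧ Odd x then b * chi a else 0) -
        (if Even b ∧ Odd a ∧ Odd y ∧ Even x then b * chi a else 0)) := by
  have h1 : mixPot (a - b) b - oddPot a b = a * chi b + b * chi a := by
    simp only [mixPot, oddPot]
    push_cast
    simp only [chi_add, chi_sub]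
    rcases chi_values a with h | h | h <;> rcases chi_values b with h' | h' | h' <;>
      rw [h, h'] <;> ring
  have h2 : oddPot (a - b) b - mixPot a b = -(a * chi b) := by
    simp only [mixPot, oddPot]
    push_cast
    simp only [chi_add, chi_sub]
    rcases chi_values a with h | h | h <;> rcases chi_values b with h' | h' | h' <;>
      rw [h, h'] <;> ring
  have h3 : mixPot b (a - b) - mixPot b a = -(b * chi a) := by
    simp only [mixPot]
    push_cast
    simp only [chi_add, chi_sub]
    rcases chi_values a with h | h | h <;> rcases chi_values b with h' | h' | h' <;>
      rw [h, h'] <;> ring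
  unfold evenPot
  simp only [← Int.not_even_iff_odd, Int.even_sub, Int.even_add]
  by_cases hx : Even x <;> by_cases hy : Even y <;> by_cases ha : Even a <;>
    by_cases hb : Even b <;> simp [hx, hy, ha, hb, h1, h2, h3, -Int.not_even_iff_odd]

/-- Potential for odd `y` and even `x`. -/
def evenOddPot (a b x y : ℤ) : ℚ :=
  1 / 6 * a * chi a + 1 / 4 * b * chi a - 1 / 12 * b * chi b + 1 / 6 * a * chi (a + b) -
    1 / 12 * b * chi (a + b) + 1 / 6 * a * chi (a - b) + 1 / 12 * b * chi (a - b) +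
    3 / 2 * a * chi x + 3 / 4 * b * (chi x - chi y - chi (x + y) + chi (x - y))

/-- Potential for odd `x` and `y`. -/
def oddOddPot (a b x y : ℤ) : ℚ :=
  -1 / 12 * (a * chi a + b * chi b + (a + b) * chi (a + b) + (a - b) * chi (a - b)) -
    1 / 4 * (b * chi a + a * chi b) - 3 / 4 * (a + b) * (chi x + chi y) +
    3 / 4 * ((a + b) * chi (x + y) + (a - b) * chi (x - y))

/-- The potential for solutions of `a * x + b * y = n`. -/
def fullPot (a b x y : ℤ) : ℚ :=
  if Odd x then if Odd y then oddOddPot a b x y else evenOddPot b a y x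
  else if Odd y then evenOddPot a b x y else 0

theorem fullPot_swap (a b x y : ℤ) : fullPot b a y x = fullPot a b x y := by
  have h : oddOddPot b a y x = oddOddPot a b x y := by
    simp only [oddOddPot]
    rw [← neg_sub a b, chi_neg, add_comm b a, ← neg_sub x y, chi_neg, add_comm y x]; ring
  unfold fullPot
  simp only [← Int.not_even_iff_odd]
  by_cases hx : Even x <;> by_cases hy : Even y <;> simp [hx, hy, h, -Int.not_even_iff_odd]

set_option maxHeartbeats 2000000 in
theorem fullPot_shear (a b x y : ℤ) :
    fullPot (a - b) b x (x + y) - fullPot a b x y =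
      (if Odd x then (if Odd y then 1 else -1) * (1 / 2 * a * chi b + 3 / 2 * a * chi y) else 0) +
      (if Odd y then (if Odd x then 1 else -1) * (1 / 2 * b * chi a + 3 / 2 * b * chi x)
        else 0) := by
  have h1 : evenOddPot b (a - b) (x + y) x - oddOddPot a b x y =
      (1 / 2 * a * chi b + 3 / 2 * a * chi y) + (1 / 2 * b * chi a + 3 / 2 * b * chi x) := by
    simp only [evenOddPot, oddOddPot]
    push_cast
    simp only [chi_add, chi_sub]
    rcases chi_values a with h | h | h <;> rcases chi_values b with h' | h' | h' <;>
      rcases chi_values x with g | g | g <;> rcases chi_values y with g' | g' | g' <;>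
      rw [h, h', g, g'] <;> ring
  have h2 : oddOddPot (a - b) b x (x + y) - evenOddPot b a y x =
      -(1 / 2 * a * chi b + 3 / 2 * a * chi y) := by
    simp only [evenOddPot, oddOddPot]
    push_cast
    simp only [chi_add, chi_sub]
    rcases chi_values a with h | h | h <;> rcases chi_values b with h' | h' | h' <;>
      rcases chi_values x with g | g | g <;> rcases chi_values y with g' | g' | g' <;>
      rw [h, h', g, g'] <;> ring
  have h3 : evenOddPot (a - b) b x (x + y) - evenOddPot a b x y =
      -(1 / 2 * b * chi a + 3 / 2 * b * chi x) := by
    simp only [evenOddPot]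
    push_cast
    simp only [chi_add, chi_sub]
    rcases chi_values a with h | h | h <;> rcases chi_values b with h' | h' | h' <;>
      rcases chi_values x with g | g | g <;> rcases chi_values y with g' | g' | g' <;>
      rw [h, h', g, g'] <;> ring
  unfold fullPot
  simp only [← Int.not_even_iff_odd, Int.even_add]
  by_cases hx : Even x <;> by_cases hy : Even y <;>
    simp [hx, hy, h1, h2, h3, -Int.not_even_iff_odd]

theorem chi_one : chi 1 = 1 := by simp [chi, chiNeg3]

theorem sum_Ico_ite_odd (h : ℤ → ℚ) (w : ℕ) :
    ∑ x ∈ Ico 1 (2 * w), (if Odd (x : ℤ) then h x else 0) =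
      ∑ j ∈ range w, h (2 * j + 1) := by
  induction w with
  | zero => simp
  | succ w ih =>
    rw [sum_range_succ, ← ih]
    rcases Nat.eq_zero_or_pos w with rfl | hw
    · simp
    · rw [show 2 * (w + 1) = 2 * w + 1 + 1 by ring, sum_Ico_succ_top (by omega),
        sum_Ico_succ_top (by omega)]
      have h1 : ¬ Odd ((2 * w : ℕ) : ℤ) := by
        simp
      have h2 : Odd ((2 * w + 1 : ℕ) : ℤ) := ⟨w, by push_cast; ring⟩
      rw [if_neg h1, if_pos h2]
      push_cast
      ring

theorem sum_Ico_pairs (h : ℤ → ℚ) (w : ℕ) :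
    ∑ x ∈ Ico 1 (2 * w + 1), h x = ∑ j ∈ range w, (h (2 * j + 1) + h (2 * j + 2)) := by
  induction w with
  | zero => simp
  | succ w ih =>
    rw [sum_range_succ, ← ih, show 2 * (w + 1) + 1 = 2 * w + 1 + 1 + 1 by ring,
      sum_Ico_succ_top (by omega), sum_Ico_succ_top (by omega)]
    push_cast
    ring

theorem sum_fullPot_even (b : ℤ) (w : ℕ) :
    ∑ x ∈ Ico 1 (2 * w), fullPot 0 b x (2 * w : ℕ) =
      w / 2 * b * (chi b + 3 * chi (2 * w)) := by
  have h : ∀ x ∈ Ico 1 (2 * w), fullPot 0 b x (2 * w : ℕ) =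
      (if Odd (x : ℤ) then (fun _ => 1 / 2 * b * (chi b + 3 * chi (2 * w))) (x : ℤ) else 0) := by
    intro x _
    have : ¬ Odd ((2 * w : ℕ) : ℤ) := by
      simp
    simp only [fullPot, evenOddPot, if_neg this, chi_zero, add_zero, sub_zero]
    push_cast
    split_ifs
    · ring
    · rfl
  rw [sum_congr rfl h, sum_Ico_ite_odd (fun _ => 1 / 2 * b * (chi b + 3 * chi (2 * w))),
    sum_const, card_range, nsmul_eq_mul]
  ring

theorem sum_chi_odd (z : ℤ) (k : ℕ) :
    ∑ j ∈ range k, (chi (2 * j + 1 + 1) - chi (2 * j + 1) + chi (2 * j + 1 + z) -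
      chi (2 * j + 1 + 1 + z) + chi (2 * j + 1 + 1 - z) - chi (2 * j + 1 - z)) =
      chi (k + 1) - 1 - (chi (k + 1 - z) - chi (1 - z)) + (chi (k + 1 + z) - chi (1 + z)) := by
  induction k with
  | zero => simp [chi_one]
  | succ k ih =>
    rw [sum_range_succ, ih]
    push_cast
    simp only [chi_add, chi_sub, chi_two_mul, chi_one]
    rcases chi_values k with h | h | h <;> rcases chi_values z with h' | h' | h' <;>
      rw [h, h'] <;> norm_num

theorem sum_fullPot_odd (b : ℤ) (w : ℕ) :
    ∑ x ∈ Ico 1 (2 * w + 1), fullPot 0 b x (2 * w + 1 : ℕ) =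
      -(w / 2) * b * (chi b + 3 * chi (2 * w + 1)) + 3 / 2 * b * chi (2 * w + 1) - 3 / 2 * b := by
  rw [sum_Ico_pairs (fun x => fullPot 0 b x (2 * w + 1 : ℕ))]
  have h : ∀ j ∈ range w, fullPot 0 b (2 * j + 1) (2 * w + 1 : ℕ) +
      fullPot 0 b (2 * j + 2) (2 * w + 1 : ℕ) =
      -(1 / 2) * b * (chi b + 3 * chi (2 * w + 1)) + 3 / 4 * b *
      (chi (2 * j + 1 + 1) - chi (2 * j + 1) + chi (2 * j + 1 + (2 * w + 1)) -
      chi (2 * j + 1 + 1 + (2 * w + 1)) + chi (2 * j + 1 + 1 - (2 * w + 1)) -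
        chi (2 * j + 1 - (2 * w + 1))) := by
    intro j _
    have h1 : Odd ((2 * w + 1 : ℕ) : ℤ) := ⟨w, by push_cast; ring⟩
    have h2 : Odd (2 * (j : ℤ) + 1) := ⟨j, rfl⟩
    have h3 : ¬ Odd (2 * (j : ℤ) + 2) := by
      rw [Int.not_odd_iff_even]; exact ⟨j + 1, by ring⟩
    rw [fullPot, fullPot, if_pos h1, if_pos h2, if_neg h3, if_pos h1]
    simp only [oddOddPot, evenOddPot, zero_add, zero_sub, chi_neg, chi_zero]
    rw [show 2 * (j : ℤ) + 2 = 2 * j + 1 + 1 by ring]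
    push_cast
    ring
  rw [sum_congr rfl h, sum_add_distrib, sum_const, card_range, nsmul_eq_mul, ← mul_sum,
    sum_chi_odd]
  simp only [chi_add, chi_sub, chi_two_mul, chi_one]
  rcases chi_values w with h | h | h <;> rw [h] <;> ring

theorem sum_odd_pot_aux (m : ℤ) (k : ℕ) :
    ∑ i ∈ range k, (oddPot (2 * i + 1) (2 * m - (2 * i + 1)) + oddOddPot i (m - i) 0 0) =
      1 / 2 * chi k * (1 - chi m ^ 2) + k * (-(3 / 2) + 3 / 2 * chi m ^ 2 -
        1 / 4 * chi k * (1 - chi m ^ 2) + 9 / 4 * chi k ^ 2 * (1 - chi m ^ 2)) +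
      m * (1 / 8 * chi k - 3 / 8 * chi k * chi m - 9 / 8 * chi k ^ 2 -
        1 / 8 * chi k ^ 2 * chi m) + 1 / 4 * k * m * chi m := by
  induction k with
  | zero => simp [chi_zero]
  | succ k ih =>
    rw [sum_range_succ, ih]
    simp only [oddPot, oddOddPot]
    push_cast
    simp only [chi_add, chi_sub, chi_two_mul, chi_one, chi_zero]
    rcases chi_values k with h | h | h <;> rcases chi_values m with h' | h' | h' <;>
      rw [h, h'] <;> ring

theorem sum_odd_pot (d : ℤ) (m : ℕ) :
    ∑ a ∈ Ico 1 (2 * m), (if Odd (a : ℤ) then oddPot a ((2 * m : ℕ) - a) else 0) +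
      ∑ a ∈ Ico 1 m, oddOddPot a (m - a) d d =
      1 / 4 * (m ^ 2 + m) * chi m - 9 / 4 * m * (m - 1) * chi d - 3 / 2 * m := by
  rw [sum_Ico_ite_odd (fun a => oddPot a ((2 * m : ℕ) - a))]
  have h : ∀ a : ℕ, oddOddPot a (m - a) d d = oddOddPot a (m - a) 0 0 - 9 / 4 * m * chi d := by
    intro a
    simp only [oddOddPot, ← two_mul d, chi_two_mul]
    push_cast
    simp only [sub_self, chi_zero, add_zero]
    ring
  have h2 := sum_odd_pot_aux m m
  rw [sum_add_distrib] at h2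
  rcases Nat.eq_zero_or_pos m with rfl | hm
  · simp
  rw [sum_congr rfl fun a _ => h a, sum_sub_distrib, sum_const, Nat.card_Ico, nsmul_eq_mul]
  rw [range_eq_Ico, sum_eq_sum_Ico_succ_bot hm (fun i : ℕ => oddOddPot i (m - i) 0 0)] at h2
  have h3 : oddOddPot ((0 : ℕ) : ℤ) ((m : ℤ) - (0 : ℕ)) 0 0 = -(1 / 4) * m * chi m := by
    simp only [oddOddPot, Nat.cast_zero, sub_zero, zero_sub, chi_neg, chi_zero, zero_add]
    push_cast
    ring
  rw [h3, zero_add] at h2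
  rw [range_eq_Ico]
  push_cast [hm] at h2 ⊢
  have h4 : chi m ^ 3 = chi m := by rcases chi_values m with h | h | h <;> rw [h] <;> norm_num
  linear_combination h2 + (-1 / 2 + m / 8 - 9 / 4 * m * chi m) * h4

/-- The sum of `a * chi b` over the solutions of `a * x + b * y = 2 * n` in odd numbers. -/
theorem two_mul_quadSum_odd_sub (n : ℕ) :
    2 * (quadSum (2 * n)
        (fun a b x y => if Odd a ∧ Odd b ∧ Odd x ∧ Odd y then a * chi b else 0) -
      2 * quadSum n (fun a b x _ => if Odd x ∧ Odd b then a * chi b else 0)) =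
      quadSum (2 * n) (fun a b x y => if a = b then evenPot 0 b x (x + y) else 0) -
        quadSum (2 * n) (fun a b x y => if x = y then evenPot a b x y else 0) := by
  have h : quadSum (2 * n)
        (fun a b x y => if Even a ∧ Odd b ∧ Odd x ∧ Even y then a * chi b else 0) =
      quadSum n (fun a b x y => if Odd x ∧ Odd b then 2 * (a * chi b) else 0) := by
    refine quadSum_transfer (fun a b x y => Even a ∧ Odd b ∧ Odd x ∧ Even y)
      (fun _ b x _ => Odd x ∧ Odd b) _ _
      (fun q => (q.1 / 2, q.2.1, q.2.2.1, q.2.2.2 / 2))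
      (fun q => (2 * q.1, q.2.1, q.2.2.1, 2 * q.2.2.2)) ?_ ?_
    · rintro a b x y ha hb hx hy e ⟨⟨a, rfl⟩, hb', hx', ⟨y, rfl⟩⟩ a' b' x' y' h
      obtain ⟨rfl, rfl, rfl, rfl⟩ : a = a' ∧ b = b' ∧ x = x' ∧ y = y' := by
        simpa [← two_mul] using h
      push_cast at e ⊢
      exact ⟨⟨by omega, hb, hx, by omega, by linarith, hx', hb'⟩, by ring, by simp [two_mul]⟩
    · rintro a b x y ha hb hx hy e ⟨hx', hb'⟩ a' b' x' y' h
      obtain ⟨rfl, rfl, rfl, rfl⟩ : 2 * a = a' ∧ b = b' ∧ x = x' ∧ 2 * y = y' := by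
        simpa using h
      push_cast
      exact ⟨⟨by omega, hb, hx, by omega, by linarith, even_two_mul a, hb', hx',
        even_two_mul y⟩, by simp⟩
  rw [← two_mul_quadSum _ _ evenPot_swap evenPot_shear, quadSum_sub, h, ← quadSum_mul]
  simp only [mul_ite, mul_zero]

theorem four_mul_quadSum_odd (n : ℕ) :
    4 * quadSum n (fun a b x _ => if Odd x ∧ Odd b then a * chi b else 0) =
      quadSum n (fun a b x y => if a = b then fullPot 0 b x (x + y) else 0) -
        quadSum n (fun a b x y => if x = y then fullPot a b x y else 0) := by
  rw [← two_mul_quadSum _ _ fullPot_swap fullPot_shear]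
  set Po := quadSum n (fun a b x _ => if Odd x ∧ Odd b then a * chi b else 0) with hPo
  set Pe := quadSum n (fun a b x _ => if Odd x ∧ ¬ Odd b then a * chi b else 0) with hPe
  set Qo := quadSum n (fun a b x y => if Odd x ∧ Odd y then a * chi b else 0) with hQo
  set Qe := quadSum n (fun a b x y => if Odd x ∧ ¬ Odd y then a * chi b else 0) with hQe
  have h1 : quadSum n (fun a _ x y => if Odd x ∧ Odd y then a * chi y else 0) = Po :=
    quadSum_swap_right n (fun a b x y => if Odd x ∧ Odd b then a * chi b else 0)
  have h2 : quadSum n (fun a _ x y => if Odd x ∧ ¬ Odd y then a * chi y else 0) = Pe :=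
    quadSum_swap_right n (fun a b x y => if Odd x ∧ ¬ Odd b then a * chi b else 0)
  have h3 : Po + Pe = Qo + Qe := by
    rw [hPo, hPe, hQo, hQe, ← quadSum_add, ← quadSum_add]
    refine quadSum_congr fun a b x y _ _ _ _ _ => ?_
    by_cases hx : Odd x <;> by_cases hy : Odd y <;> by_cases hb : Odd b <;> simp [hx, hy, hb]
  have h4 : Qe = -1 * Pe := by
    rw [hPe, ← quadSum_mul]
    simp only [mul_ite, mul_zero]
    refine quadSum_transfer (fun a b x y => Odd x ∧ ¬ Odd y)
      (fun _ b x _ => Odd x ∧ ¬ Odd b) _ _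
      (fun q => (q.1, 2 * q.2.1, q.2.2.1, q.2.2.2 / 2))
      (fun q => (q.1, q.2.1 / 2, q.2.2.1, 2 * q.2.2.2)) ?_ ?_
    · rintro a b x y ha hb hx hy e ⟨hx', hy'⟩ a' b' x' y' h
      obtain ⟨y, rfl⟩ := Int.not_odd_iff_even.1 hy'
      obtain ⟨rfl, rfl, rfl, rfl⟩ : a = a' ∧ 2 * b = b' ∧ x = x' ∧ y = y' := by
        simpa [← two_mul] using h
      rw [chi_two_mul]
      exact ⟨⟨ha, by omega, hx, by omega, by linarith, hx',
        Int.not_odd_iff_even.2 (even_two_mul b)⟩, by ring, by simp [← two_mul]⟩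
    · rintro a b x y ha hb hx hy e ⟨hx', hb'⟩ a' b' x' y' h
      obtain ⟨b, rfl⟩ := Int.not_odd_iff_even.1 hb'
      obtain ⟨rfl, rfl, rfl, rfl⟩ : a = a' ∧ b = b' ∧ x = x' ∧ 2 * y = y' := by
        simpa [← two_mul] using h
      exact ⟨⟨ha, by omega, hx, by omega, by linarith, hx',
        Int.not_odd_iff_even.2 (even_two_mul y)⟩, by simp [← two_mul]⟩
  have h5 : quadSum n (fun a b x y => if Odd x then
      (if Odd y then 1 else -1) * (1 / 2 * a * chi b + 3 / 2 * a * chi y) else 0) =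
      1 / 2 * Qo + 3 / 2 * Po - (1 / 2 * Qe + 3 / 2 * Pe) := by
    rw [← h1, ← h2, hQo, hQe, ← quadSum_mul, ← quadSum_mul, ← quadSum_mul, ← quadSum_mul,
      ← quadSum_add, ← quadSum_add, ← quadSum_sub]
    refine quadSum_congr fun a b x y _ _ _ _ _ => ?_
    by_cases hx : Odd x <;> by_cases hy : Odd y <;> simp [hx, hy] <;> ring
  rw [h5]
  linear_combination h3 + 2 * h4

theorem sum_divisors_two_mul {n : ℕ} (f : ℕ → ℚ) (hf : ∀ d, Even d → f d = 0) :
    ∑ d ∈ (2 * n).divisors, f d = ∑ d ∈ n.divisors, f d := by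
  rcases Nat.eq_zero_or_pos n with rfl | hn
  · simp
  refine (sum_subset (Nat.divisors_subset_of_dvd (by omega) (Dvd.intro_left 2 rfl)) ?_).symm
  intro d hd hd'
  refine hf d ?_
  by_contra h
  refine hd' (Nat.mem_divisors.2 ⟨?_, hn.ne'⟩)
  exact (Nat.Coprime.dvd_mul_left (by simpa using Nat.not_even_iff_odd.1 h)).1
    (Nat.dvd_of_mem_divisors hd)

theorem diag_left_evenPot (n : ℕ) :
    quadSum (2 * n) (fun a b x y => if a = b then evenPot 0 b x (x + y) else 0) =
      n * ∑ d ∈ n.divisors, if Odd d then chi d else 0 := by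
  rw [quadSum_diag_left (2 * n) (fun _ b x y => evenPot 0 b x (x + y)), sum_divisors_two_mul,
    mul_sum]
  · refine sum_congr rfl fun d hd => ?_
    obtain ⟨m, rfl⟩ := Nat.dvd_of_mem_divisors hd
    have hd0 : 0 < d := Nat.pos_of_mem_divisors hd
    have e : 2 * (d * m) / d = 2 * m := by
      rw [show 2 * (d * m) = d * (2 * m) by ring, Nat.mul_div_cancel_left _ hd0]
    by_cases h : Odd d
    · have h0 : ∀ x ∈ Ico 1 (2 * m), evenPot 0 d x (x + ((2 * m : ℕ) - x)) =
          if Odd (x : ℤ) then (fun _ => d * chi d) (x : ℤ) else 0 := by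
        intro x _
        have h1 : ¬ Odd ((2 * m : ℕ) : ℤ) := by simp
        have h2 : Odd (d : ℤ) := by exact_mod_cast h
        have h3 : mixPot 0 d = d * chi d := by
          simp only [mixPot, chi_zero, zero_add, zero_sub, chi_neg]
          push_cast
          ring
        have h4 : Even (0 : ℤ) ∧ Odd (d : ℤ) := ⟨by simp, h2⟩
        simp only [add_sub_cancel, evenPot, h1, false_and, if_false, if_pos h4, h3]
      rw [e, sum_congr rfl h0, sum_Ico_ite_odd (fun _ => d * chi d), if_pos h, sum_const,
        card_range, nsmul_eq_mul]
      push_cast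
      ring
    · have h2 : ¬ Odd (d : ℤ) := by exact_mod_cast h
      simp [evenPot, h2, h]
  · intro d hd
    have h2 : ¬ Odd (d : ℤ) := by simpa using hd
    simp [evenPot, h2]

theorem diag_right_evenPot (n : ℕ) :
    quadSum (2 * n) (fun a b x y => if x = y then evenPot a b x y else 0) =
      ∑ d ∈ n.divisors, if Odd d then ∑ a ∈ Ico 1 (2 * (n / d)),
        (if Odd (a : ℤ) then oddPot a ((2 * (n / d) : ℕ) - a) else 0) else 0 := by
  rw [quadSum_diag_right, sum_divisors_two_mul]
  · refine sum_congr rfl fun d hd => ?_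
    obtain ⟨m, rfl⟩ := Nat.dvd_of_mem_divisors hd
    have hd0 : 0 < d := Nat.pos_of_mem_divisors hd
    rw [show 2 * (d * m) / d = 2 * m by
      rw [show 2 * (d * m) = d * (2 * m) by ring, Nat.mul_div_cancel_left _ hd0],
      Nat.mul_div_cancel_left _ hd0]
    by_cases h : Odd d
    · rw [if_pos h]
      refine sum_congr rfl fun a _ => ?_
      have h2 : Odd (d : ℤ) := by exact_mod_cast h
      rw [evenPot, if_pos h2, if_pos h2]
      refine if_congr ?_ rfl rfl
      have : Odd (((2 * m : ℕ) : ℤ) - a) ↔ Odd (a : ℤ) := by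
        rw [Int.odd_sub, ← Int.not_even_iff_odd]; simp
      rw [this, and_self]
    · have h2 : ¬ Odd (d : ℤ) := by exact_mod_cast h
      simp [evenPot, h2, h]
  · intro d hd
    have h2 : ¬ Odd (d : ℤ) := by simpa using hd
    simp [evenPot, h2]

theorem diag_left_fullPot (n : ℕ) :
    quadSum n (fun a b x y => if a = b then fullPot 0 b x (x + y) else 0) =
      ∑ p ∈ n.divisorsAntidiagonal, if Odd p.2 then
        -(n - p.1) / 4 * (chi p.1 + 3 * chi p.2) + 3 / 2 * p.1 * chi p.2 - 3 / 2 * p.1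
        else n / 4 * (chi p.1 + 3 * chi p.2) := by
  rw [quadSum_diag_left n (fun _ b x y => fullPot 0 b x (x + y)),
    ← Nat.sum_divisorsAntidiagonal (fun d m => ∑ x ∈ Ico 1 m,
      fullPot 0 d x (x + (m - x)))]
  refine sum_congr rfl ?_
  rintro ⟨d, m⟩ hp
  obtain ⟨rfl, -⟩ := Nat.mem_divisorsAntidiagonal.1 hp
  simp only [add_sub_cancel]
  by_cases h : Odd m
  · rw [if_pos h]
    obtain ⟨w, rfl⟩ := h
    rw [sum_fullPot_odd]
    push_cast
    ring
  · rw [if_neg h]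
    obtain ⟨w, rfl⟩ := Nat.not_odd_iff_even.1 h
    rw [← two_mul, sum_fullPot_even]
    push_cast
    ring

theorem diag_right_fullPot (n : ℕ) :
    quadSum n (fun a b x y => if x = y then fullPot a b x y else 0) =
      ∑ d ∈ n.divisors, if Odd d then ∑ a ∈ Ico 1 (n / d),
        oddOddPot a ((n / d : ℕ) - a) d d else 0 := by
  rw [quadSum_diag_right]
  refine sum_congr rfl fun d _ => ?_
  by_cases h : Odd d
  · have h2 : Odd (d : ℤ) := by exact_mod_cast h
    simp [fullPot, h2, h]
  · have h2 : ¬ Odd (d : ℤ) := by exact_mod_cast h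
    simp [fullPot, h2, h]

theorem sum_chi_even_divisors (n : ℕ) :
    ∑ p ∈ n.divisorsAntidiagonal, (if Odd p.1 then 0 else chi p.1) =
      -∑ p ∈ n.divisorsAntidiagonal, (if Odd p.2 then 0 else chi p.1) := by
  rw [← sum_neg_distrib, ← sum_filter_add_sum_filter_not _ (fun p : ℕ × ℕ => ¬ Odd p.1),
    ← sum_filter_add_sum_filter_not _ (fun p : ℕ × ℕ => ¬ Odd p.2)
      (fun p : ℕ × ℕ => -(if Odd p.2 then 0 else chi p.1))]
  congr 1
  · refine sum_bij' (fun p _ => (p.1 / 2, 2 * p.2)) (fun p _ => (2 * p.1, p.2 / 2)) ?_ ?_ ?_ ?_ ?_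
    all_goals
      rintro ⟨d, m⟩ hp
      simp only [mem_filter, Nat.mem_divisorsAntidiagonal, Nat.not_odd_iff_even] at hp
    · obtain ⟨⟨rfl, h⟩, ⟨d, rfl⟩⟩ := hp
      simp only [mem_filter, Nat.mem_divisorsAntidiagonal]
      refine ⟨⟨?_, h⟩, by simp⟩
      rw [show (d + d) / 2 = d by omega]; ring
    · obtain ⟨⟨rfl, h⟩, ⟨m, rfl⟩⟩ := hp
      simp only [mem_filter, Nat.mem_divisorsAntidiagonal]
      refine ⟨⟨?_, h⟩, by simp⟩
      rw [show (m + m) / 2 = m by omega]; ring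
    · obtain ⟨-, ⟨d, rfl⟩⟩ := hp
      simp [← two_mul]
    · obtain ⟨-, ⟨m, rfl⟩⟩ := hp
      simp [← two_mul]
    · obtain ⟨-, ⟨d, rfl⟩⟩ := hp
      have h1 : ¬ Odd (2 * d) := Nat.not_odd_iff_even.2 (even_two_mul d)
      have h2 : ¬ Odd (2 * m) := Nat.not_odd_iff_even.2 (even_two_mul m)
      simp [← two_mul, chi_two_mul, h1, h2]
  · rw [sum_eq_zero, sum_eq_zero]
    · intro p hp
      simp only [mem_filter, not_not] at hp
      simp [hp.2]
    · intro p hp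
      simp only [mem_filter, not_not] at hp
      simp [hp.2]

theorem sum_chi_divisors_balance (n : ℕ) :
    ∑ p ∈ n.divisorsAntidiagonal, ((if Odd p.1 then chi p.1 else 0) +
      1 / 4 * (if Odd p.2 then -1 else 1) * (chi p.1 + 3 * chi p.2)) = 0 := by
  have h := sum_chi_even_divisors n
  have h2 : ∑ p ∈ n.divisorsAntidiagonal, (if Odd p.2 then -1 else 1) * chi p.2 =
      ∑ p ∈ n.divisorsAntidiagonal, (if Odd p.1 then -1 else 1) * chi p.1 := by
    rw [Nat.sum_divisorsAntidiagonal (fun a b => (if Odd b then -1 else 1) * chi b),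
      Nat.sum_divisorsAntidiagonal' (fun a b => (if Odd a then -1 else 1) * chi a)]
  have h3 : ∑ p ∈ n.divisorsAntidiagonal, ((if Odd p.1 then chi p.1 else 0) +
      1 / 4 * (if Odd p.2 then -1 else 1) * (chi p.1 + 3 * chi p.2)) =
      ∑ p ∈ n.divisorsAntidiagonal, (1 / 2 * (if Odd p.1 then 0 else chi p.1)
        + 1 / 2 * (if Odd p.2 then 0 else chi p.1)) +
      3 / 4 * (∑ p ∈ n.divisorsAntidiagonal, (if Odd p.2 then -1 else 1) * chi p.2 -
        ∑ p ∈ n.divisorsAntidiagonal, (if Odd p.1 then -1 else 1) * chi p.1) := by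
    rw [← sum_sub_distrib, mul_sum, ← sum_add_distrib]
    refine sum_congr rfl fun p _ => ?_
    split_ifs <;> ring
  rw [h3, h2, sub_self, sum_add_distrib, ← mul_sum, ← mul_sum, h]
  ring

theorem quadSum_odd_eq (n : ℕ) :
    quadSum (2 * n) (fun a b x y => if Odd a ∧ Odd b ∧ Odd x ∧ Odd y then a * chi b else 0) =
      ∑ p ∈ n.divisorsAntidiagonal, if Odd p.2 then
        (-(1 / 8) * chi p.1 + 9 / 8 * chi p.2) * p.1 ^ 2 else 0 := by
  have h1 := two_mul_quadSum_odd_sub n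
  have h2 := four_mul_quadSum_odd n
  have h3 : quadSum (2 * n) (fun a b x y => if x = y then evenPot a b x y else 0) +
      quadSum n (fun a b x y => if x = y then fullPot a b x y else 0) =
      ∑ p ∈ n.divisorsAntidiagonal, if Odd p.2 then
        1 / 4 * (p.1 ^ 2 + p.1) * chi p.1 - 9 / 4 * p.1 * (p.1 - 1) * chi p.2 - 3 / 2 * p.1
        else 0 := by
    rw [diag_right_evenPot, diag_right_fullPot, ← sum_add_distrib,
      Nat.sum_divisorsAntidiagonal' (fun a b => if Odd b then
        1 / 4 * ((a : ℚ) ^ 2 + a) * chi a - 9 / 4 * a * (a - 1) * chi b - 3 / 2 * a else 0)]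
    refine sum_congr rfl fun d _ => ?_
    split_ifs
    · exact sum_odd_pot d (n / d)
    · simp
  have h4 : (n : ℚ) * ∑ p ∈ n.divisorsAntidiagonal, ((if Odd p.1 then chi p.1 else 0) +
      1 / 4 * (if Odd p.2 then -1 else 1) * (chi p.1 + 3 * chi p.2)) = 0 := by
    rw [sum_chi_divisors_balance, mul_zero]
  rw [diag_left_evenPot, ← Nat.sum_divisorsAntidiagonal (fun a _ => if Odd a then chi a else 0)]
    at h1
  rw [diag_left_fullPot] at h2
  have h5 : n * ∑ p ∈ n.divisorsAntidiagonal, (if Odd p.1 then chi p.1 else 0) +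
      ∑ p ∈ n.divisorsAntidiagonal, (if Odd p.2 then
        -(n - p.1) / 4 * (chi p.1 + 3 * chi p.2) + 3 / 2 * p.1 * chi p.2 - 3 / 2 * p.1
        else n / 4 * (chi p.1 + 3 * chi p.2)) -
      (∑ p ∈ n.divisorsAntidiagonal, if Odd p.2 then
        1 / 4 * (p.1 ^ 2 + p.1) * chi p.1 - 9 / 4 * p.1 * (p.1 - 1) * chi p.2 - 3 / 2 * p.1
        else 0) =
      n * ∑ p ∈ n.divisorsAntidiagonal, ((if Odd p.1 then chi p.1 else 0) +
      1 / 4 * (if Odd p.2 then -1 else 1) * (chi p.1 + 3 * chi p.2)) +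
      2 * ∑ p ∈ n.divisorsAntidiagonal, if Odd p.2 then
        (-(1 / 8) * chi p.1 + 9 / 8 * chi p.2) * p.1 ^ 2 else 0 := by
    rw [mul_sum, mul_sum, mul_sum, ← sum_add_distrib, ← sum_sub_distrib, ← sum_add_distrib]
    refine sum_congr rfl fun p _ => ?_
    split_ifs <;> ring
  linear_combination (h1 + h2 - h3 + h4 + h5) / 2

theorem sum_divisorsAntidiagonal_two_mul (f : ℕ → ℕ → ℚ) {k : ℕ} (hk : 0 < k) :
    ∑ p ∈ (2 * k).divisorsAntidiagonal, (if Odd p.2 then 0 else f p.1 p.2) =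
      ∑ p ∈ k.divisorsAntidiagonal, f p.1 (2 * p.2) := by
  rw [← sum_filter_add_sum_filter_not _ (fun p : ℕ × ℕ => Odd p.2), sum_eq_zero, zero_add]
  · refine sum_bij' (fun p _ => (p.1, p.2 / 2)) (fun p _ => (p.1, 2 * p.2)) ?_ ?_ ?_ ?_ ?_
    · rintro ⟨d, m⟩ hp
      simp only [mem_filter, Nat.mem_divisorsAntidiagonal, Nat.not_odd_iff_even] at hp ⊢
      obtain ⟨⟨h, -⟩, ⟨m, rfl⟩⟩ := hp
      refine ⟨?_, hk.ne'⟩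
      rw [show (m + m) / 2 = m by omega]
      linarith
    · rintro ⟨d, m⟩ hp
      simp only [mem_filter, Nat.mem_divisorsAntidiagonal, Nat.not_odd_iff_even] at hp ⊢
      exact ⟨⟨by rw [← hp.1]; ring, by omega⟩, even_two_mul m⟩
    · rintro ⟨d, m⟩ hp
      simp only [mem_filter, Nat.not_odd_iff_even] at hp
      obtain ⟨-, ⟨m, rfl⟩⟩ := hp
      simp [← two_mul]
    · rintro ⟨d, m⟩ hp
      simp
    · rintro ⟨d, m⟩ hp
      simp only [mem_filter, Nat.not_odd_iff_even] at hp
      obtain ⟨-, ⟨m, rfl⟩⟩ := hp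
      have h2 : ¬ Odd (2 * m) := Nat.not_odd_iff_even.2 (even_two_mul m)
      simp [← two_mul, h2]
  · intro p hp
    rw [if_pos (mem_filter.1 hp).2]

theorem sum_divisorsAntidiagonal_odd {n : ℕ} (hn : 1 ≤ n) {A B : ℕ → ℤ}
    (hA : ∀ m : ℕ, A m = ∑ d ∈ m.divisors, chiNeg3 (d : ℤ) * (d : ℤ) ^ 2)
    (hB : ∀ m : ℕ, B m = ∑ d ∈ m.divisors, chiNeg3 ((m / d : ℕ) : ℤ) * (d : ℤ) ^ 2) :
    ∑ p ∈ n.divisorsAntidiagonal, (if Odd p.2 then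
        (-(1 / 8) * chi p.1 + 9 / 8 * chi p.2) * p.1 ^ 2 else 0) =
      -(1 / 8) * (A n : ℚ) + (1 / 8) * (if 2 ∣ n then (A (n / 2) : ℚ) else 0) +
        (9 / 8) * (B n : ℚ) + (9 / 8) * (if 2 ∣ n then (B (n / 2) : ℚ) else 0) := by
  have hA' : ∀ m, (A m : ℚ) = ∑ p ∈ m.divisorsAntidiagonal, chi p.1 * p.1 ^ 2 := by
    intro m
    rw [hA, Nat.sum_divisorsAntidiagonal (fun a _ => chi a * (a : ℚ) ^ 2)]
    push_cast
    rfl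
  have hB' : ∀ m, (B m : ℚ) = ∑ p ∈ m.divisorsAntidiagonal, chi p.2 * p.1 ^ 2 := by
    intro m
    rw [hB, Nat.sum_divisorsAntidiagonal (fun a b => chi b * (a : ℚ) ^ 2)]
    push_cast
    rfl
  split_ifs with h
  · obtain ⟨k, rfl⟩ := h
    have hk : 0 < k := by omega
    have h1 := sum_divisorsAntidiagonal_two_mul (fun a _ => chi a * (a : ℚ) ^ 2) hk
    have h2 := sum_divisorsAntidiagonal_two_mul (fun a b => -chi b * (a : ℚ) ^ 2) hk
    simp only [Nat.cast_mul, Nat.cast_ofNat, chi_two_mul, neg_neg] at h2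
    rw [Nat.mul_div_cancel_left k two_pos, hA', hA', hB', hB', ← h1, ← h2, mul_sum, mul_sum,
      mul_sum, mul_sum, ← sum_add_distrib, ← sum_add_distrib, ← sum_add_distrib]
    refine sum_congr rfl fun p _ => ?_
    split_ifs <;> ring
  · have hn' : Odd n := Nat.odd_iff.2 (by omega)
    simp only [mul_zero, add_zero]
    rw [hA', hB', mul_sum, mul_sum, ← sum_add_distrib]
    refine sum_congr rfl fun p hp => ?_
    have h2 : Odd p.2 := by
      exact hn'.of_dvd_nat (Dvd.intro_left _ (Nat.mem_divisorsAntidiagonal.1 hp).1)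
    rw [if_pos h2]
    ring

theorem sum_divisors_prime_mul {χ : ℕ → ℤ} (hχ : ∀ a b, χ (a * b) = χ a * χ b) {p m : ℕ}
    (hp : p.Prime) (hm : 0 < m) :
    ∑ d ∈ (p * m).divisors, χ d = (1 + χ p) * ∑ d ∈ m.divisors, χ d -
      χ p * (if p ∣ m then ∑ d ∈ (m / p).divisors, χ d else 0) := by
  have hinj : Function.Injective (p * ·) := fun a b h => Nat.eq_of_mul_eq_mul_left hp.pos h
  have h1 : (p * m).divisors = m.divisors ∪ m.divisors.image (p * ·) := by
    ext d
    simp only [mem_union, mem_image, Nat.mem_divisors, Nat.dvd_mul]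
    constructor
    · rintro ⟨⟨a, b, ha, hb, rfl⟩, -⟩
      rcases (Nat.dvd_prime hp).1 ha with rfl | rfl
      · left; rw [one_mul]; exact ⟨hb, hm.ne'⟩
      · right; exact ⟨b, ⟨hb, hm.ne'⟩, rfl⟩
    · have h0 : p * m ≠ 0 := (Nat.mul_pos hp.pos hm).ne'
      rintro (⟨h, -⟩ | ⟨b, ⟨hb, -⟩, rfl⟩)
      · exact ⟨⟨1, d, one_dvd _, h, one_mul d⟩, h0⟩
      · exact ⟨⟨p, b, dvd_rfl, hb, rfl⟩, h0⟩
  have h2 : ∑ d ∈ m.divisors ∩ m.divisors.image (p * ·), χ d =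
      χ p * (if p ∣ m then ∑ d ∈ (m / p).divisors, χ d else 0) := by
    split_ifs with h
    · obtain ⟨k, rfl⟩ := h
      have hk : 0 < k := Nat.pos_of_mul_pos_left hm
      have h3 : (p * k).divisors ∩ (p * k).divisors.image (p * ·) =
          k.divisors.image (p * ·) := by
        ext d
        simp only [mem_inter, mem_image, Nat.mem_divisors]
        constructor
        · rintro ⟨⟨h, -⟩, ⟨b, -, rfl⟩⟩
          exact ⟨b, ⟨Nat.dvd_of_mul_dvd_mul_left hp.pos h, hk.ne'⟩, rfl⟩
        · rintro ⟨b, ⟨hb, -⟩, rfl⟩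
          exact ⟨⟨Nat.mul_dvd_mul_left p hb, hm.ne'⟩, b, ⟨hb.mul_left p, hm.ne'⟩, rfl⟩
      rw [h3, sum_image hinj.injOn, Nat.mul_div_cancel_left k hp.pos, mul_sum]
      exact sum_congr rfl fun d _ => hχ p d
    · rw [mul_zero]
      refine sum_eq_zero fun d hd => absurd ?_ h
      simp only [mem_inter, mem_image, Nat.mem_divisors] at hd
      obtain ⟨⟨h, -⟩, ⟨b, -, rfl⟩⟩ := hd
      exact (Dvd.intro _ rfl).trans h
  have h3 := sum_union_inter (s₁ := m.divisors) (s₂ := m.divisors.image (p * ·)) (f := χ)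
  rw [← h1, h2, sum_image hinj.injOn, sum_congr rfl fun d _ => hχ p d, ← mul_sum] at h3
  linear_combination h3

/-- The integer solutions of `u ^ 2 + D * v ^ 2 = N`. -/
noncomputable def normReps (D N : ℕ) : Finset (ℤ × ℤ) :=
  (Icc (-(N : ℤ)) N ×ˢ Icc (-(N : ℤ)) N).filter fun w => w.1 ^ 2 + D * w.2 ^ 2 = N

theorem mem_normReps {D N : ℕ} (hD : 0 < D) {u v : ℤ} :
    (u, v) ∈ normReps D N ↔ u ^ 2 + D * v ^ 2 = N := by
  simp only [normReps, mem_filter, mem_product, mem_Icc, and_iff_right_iff_imp, ← abs_le]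
  intro h
  have hD' : (1 : ℤ) ≤ D := by exact_mod_cast hD
  have h0 : ∀ z : ℤ, |z| ≤ z ^ 2 := fun z => by
    rw [← Int.natCast_natAbs, ← Int.natAbs_sq]
    exact_mod_cast Nat.le_self_pow two_ne_zero _
  have h1 := h0 u
  have h2 := h0 v
  constructor <;> nlinarith [sq_nonneg u, sq_nonneg v]

theorem card_normReps_filter_dvd {D p m : ℕ} (hD : 0 < D) (hp : p.Prime) :
    ((normReps D (p * m)).filter fun w => (p : ℤ) ∣ w.1 ∧ (p : ℤ) ∣ w.2).card =
      if p ∣ m then (normReps D (m / p)).card else 0 := by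
  have hp0 : (p : ℤ) ≠ 0 := by exact_mod_cast hp.ne_zero
  split_ifs with h
  · obtain ⟨k, rfl⟩ := h
    rw [Nat.mul_div_cancel_left k hp.pos]
    symm
    refine card_bij (fun w _ => (p * w.1, p * w.2)) ?_ ?_ ?_
    · rintro ⟨a, b⟩ h
      rw [mem_normReps hD] at h
      rw [mem_filter, mem_normReps hD]
      refine ⟨?_, Dvd.intro _ rfl, Dvd.intro _ rfl⟩
      push_cast
      linear_combination (p : ℤ) ^ 2 * h
    · rintro ⟨a, b⟩ - ⟨a', b'⟩ - h
      simpa [hp.ne_zero] using h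
    · rintro ⟨u, v⟩ h
      rw [mem_filter, mem_normReps hD] at h
      obtain ⟨h, ⟨a, ha⟩, ⟨b, hb⟩⟩ := h
      dsimp only at ha hb
      subst ha hb
      refine ⟨(a, b), ?_, rfl⟩
      rw [mem_normReps hD]
      push_cast at h
      have : (p : ℤ) * p * (a ^ 2 + D * b ^ 2) = p * p * k := by linear_combination h
      exact mul_left_cancel₀ (mul_ne_zero hp0 hp0) this
  · rw [card_eq_zero, filter_eq_empty_iff]
    rintro ⟨u, v⟩ hw ⟨⟨a, ha⟩, ⟨b, hb⟩⟩
    rw [mem_normReps hD] at hw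
    dsimp only at ha hb
    subst ha hb
    refine h ?_
    rw [← Int.natCast_dvd_natCast]
    refine ⟨a ^ 2 + D * b ^ 2, ?_⟩
    push_cast at hw
    refine mul_left_cancel₀ hp0 ?_
    linear_combination -hw

theorem card_normReps_filter_split {D p m : ℕ} (hD : 0 < D) (hp : p.Prime) {s t : ℤ}
    (hst : (p : ℤ) = s ^ 2 + D * t ^ 2) :
    ((normReps D (p * m)).filter fun w => (p : ℤ) ∣ w.2 * s - w.1 * t).card =
      (normReps D m).card := by
  have hp0 : (p : ℤ) ≠ 0 := by exact_mod_cast hp.ne_zero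
  symm
  refine card_bij (fun w _ => (w.1 * s - D * w.2 * t, w.1 * t + w.2 * s)) ?_ ?_ ?_
  · rintro ⟨a, b⟩ h
    rw [mem_normReps hD] at h
    rw [mem_filter, mem_normReps hD]
    refine ⟨?_, b, ?_⟩
    · push_cast
      rw [← h, hst]
      ring
    · dsimp only
      rw [hst]
      ring
  · rintro ⟨a, b⟩ - ⟨a', b'⟩ - h
    simp only [Prod.mk.injEq] at h ⊢
    obtain ⟨h1, h2⟩ := h
    constructor <;> refine mul_left_cancel₀ hp0 ?_
    · linear_combination s * h1 + D * t * h2 + (a - a') * hst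
    · linear_combination s * h2 - t * h1 + (b - b') * hst
  · rintro ⟨u, v⟩ h
    rw [mem_filter, mem_normReps hD] at h
    obtain ⟨h, ⟨b, hb⟩⟩ := h
    dsimp only at hb
    push_cast at h
    have h1 : (p : ℤ) ∣ u * s + D * v * t := by
      refine (Nat.prime_iff_prime_int.1 hp).dvd_of_dvd_pow (n := 2) ⟨p * m - D * p * b ^ 2, ?_⟩
      linear_combination p * h - D * (p * b + v * s - u * t) * hb -
        (u ^ 2 + D * v ^ 2) * hst
    obtain ⟨a, ha⟩ := h1
    have hu : u = a * s - D * b * t := by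
      refine mul_left_cancel₀ hp0 ?_
      linear_combination u * hst + s * ha - D * t * hb
    have hv : v = a * t + b * s := by
      refine mul_left_cancel₀ hp0 ?_
      linear_combination v * hst + t * ha + s * hb
    refine ⟨(a, b), ?_, by rw [hu, hv]⟩
    rw [mem_normReps hD]
    refine mul_left_cancel₀ hp0 ?_
    rw [← h, hu, hv, hst]
    ring

theorem card_normReps_split {D p m : ℕ} (hD : 0 < D) (hp : p.Prime) (hp2 : p ≠ 2)
    (hpD : ¬ p ∣ D) {s t : ℤ} (hst : (p : ℤ) = s ^ 2 + D * t ^ 2) :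
    (normReps D (p * m)).card + (if p ∣ m then (normReps D (m / p)).card else 0) =
      2 * (normReps D m).card := by
  have hpp := Nat.prime_iff_prime_int.1 hp
  have hp2' : ¬ (p : ℤ) ∣ 2 := fun h =>
    hp2 ((Nat.prime_dvd_prime_iff_eq hp Nat.prime_two).1 (by exact_mod_cast h))
  have hpD' : ¬ (p : ℤ) ∣ D := by exact_mod_cast hpD
  have hs : ¬ (p : ℤ) ∣ s := by
    intro h
    have h1 : (p : ℤ) ∣ D * t ^ 2 := by
      rw [show (D : ℤ) * t ^ 2 = p - s ^ 2 by rw [hst]; ring]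
      exact dvd_sub dvd_rfl (dvd_pow h two_ne_zero)
    have h2 := hpp.dvd_of_dvd_pow ((hpp.dvd_or_dvd h1).resolve_left hpD')
    obtain ⟨a, rfl⟩ := h
    obtain ⟨b, rfl⟩ := h2
    refine hpp.not_dvd_one ⟨a ^ 2 + D * b ^ 2, mul_left_cancel₀ hpp.ne_zero ?_⟩
    linear_combination hst
  have ht : ¬ (p : ℤ) ∣ t := by
    intro h
    refine hs (hpp.dvd_of_dvd_pow (n := 2) ?_)
    rw [show s ^ 2 = p - D * t ^ 2 by rw [hst]; ring]
    exact dvd_sub dvd_rfl ((dvd_pow h two_ne_zero).mul_left _)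
  have h1 := card_normReps_filter_split (m := m) hD hp hst
  have h2 := card_normReps_filter_split (m := m) (t := -t) hD hp (by rw [hst]; ring)
  have h3 := card_union_add_card_inter
    ((normReps D (p * m)).filter fun w => (p : ℤ) ∣ w.2 * s - w.1 * t)
    ((normReps D (p * m)).filter fun w => (p : ℤ) ∣ w.2 * s - w.1 * -t)
  rw [h1, h2, ← filter_or, ← filter_and] at h3
  rw [two_mul, ← h3, ← card_normReps_filter_dvd hD hp]
  congr 2
  · symm
    rw [filter_eq_self]
    rintro ⟨u, v⟩ h
    rw [mem_normReps hD] at h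
    refine hpp.dvd_or_dvd ⟨v ^ 2 - m * t ^ 2, ?_⟩
    push_cast at h
    dsimp only
    linear_combination -v ^ 2 * hst - t ^ 2 * h
  · refine filter_congr ?_
    rintro ⟨u, v⟩ -
    dsimp only
    constructor
    · rintro ⟨h, h'⟩
      exact ⟨dvd_sub (h'.mul_right s) (h.mul_right t), dvd_sub (h'.mul_right s) (h.mul_right _)⟩
    · rintro ⟨h, h'⟩
      have h4 : (p : ℤ) ∣ 2 * (u * t) := by
        have := dvd_sub h' h
        ring_nf at this ⊢
        exact this
      have h5 : (p : ℤ) ∣ 2 * (v * s) := by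
        have := dvd_add h' h
        ring_nf at this ⊢
        exact this
      exact ⟨(hpp.dvd_or_dvd ((hpp.dvd_or_dvd h4).resolve_left hp2')).resolve_right ht,
        (hpp.dvd_or_dvd ((hpp.dvd_or_dvd h5).resolve_left hp2')).resolve_right hs⟩

theorem card_normReps_ramified {p m : ℕ} (hp : p.Prime) :
    (normReps p (p * m)).card = (normReps p m).card := by
  have hp0 : (p : ℤ) ≠ 0 := by exact_mod_cast hp.ne_zero
  symm
  refine card_bij (fun w _ => (p * w.2, w.1)) ?_ ?_ ?_
  · rintro ⟨a, b⟩ h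
    rw [mem_normReps hp.pos] at h ⊢
    push_cast
    linear_combination (p : ℤ) * h
  · rintro ⟨a, b⟩ - ⟨a', b'⟩ - h
    simpa [hp.ne_zero, and_comm] using h
  · rintro ⟨u, v⟩ h
    rw [mem_normReps hp.pos] at h
    push_cast at h
    obtain ⟨a, rfl⟩ : (p : ℤ) ∣ u :=
      (Nat.prime_iff_prime_int.1 hp).dvd_of_dvd_pow (n := 2) ⟨m - v ^ 2, by linear_combination h⟩
    refine ⟨(v, a), ?_, rfl⟩
    rw [mem_normReps hp.pos]
    refine mul_left_cancel₀ hp0 ?_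
    linear_combination h

theorem card_normReps_inert {D p m : ℕ} (hD : 0 < D) (hp : p.Prime)
    (h : ∀ u v : ℤ, (p : ℤ) ∣ u ^ 2 + D * v ^ 2 → (p : ℤ) ∣ u ∧ (p : ℤ) ∣ v) :
    (normReps D (p * m)).card = if p ∣ m then (normReps D (m / p)).card else 0 := by
  rw [← card_normReps_filter_dvd hD hp]
  congr 1
  symm
  rw [filter_eq_self]
  rintro ⟨u, v⟩ hw
  rw [mem_normReps hD] at hw
  exact h u v (by rw [hw]; push_cast; exact Dvd.intro _ rfl)

/-- A form `u ^ 2 + D * v ^ 2` whose odd primes behave as in a principal ideal domain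
represents odd numbers as often as predicted by the divisor sum of its character. -/
theorem card_normReps_eq {D : ℕ} (hD : 0 < D) {χ : ℕ → ℤ} (h1 : χ 1 = 1)
    (hχ : ∀ a b, χ (a * b) = χ a * χ b)
    (hprime : ∀ p : ℕ, p.Prime → p ≠ 2 →
      (χ p = 1 ∧ ¬ p ∣ D ∧ ∃ s t : ℤ, (p : ℤ) = s ^ 2 + D * t ^ 2) ∨
      (χ p = -1 ∧ ∀ u v : ℤ, (p : ℤ) ∣ u ^ 2 + D * v ^ 2 → (p : ℤ) ∣ u ∧ (p : ℤ) ∣ v) ∨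
      (χ p = 0 ∧ p = D)) (N : ℕ) (hN : Odd N) :
    ((normReps D N).card : ℤ) = (normReps D 1).card * ∑ d ∈ N.divisors, χ d := by
  induction N using Nat.strong_induction_on with
  | _ N ih =>
    rcases eq_or_ne N 1 with rfl | hN1
    · simp [h1]
    obtain ⟨p, hp, m, rfl⟩ := Nat.exists_prime_and_dvd hN1
    have hodd := Nat.odd_mul.1 hN
    have hp2 : p ≠ 2 := by rintro rfl; exact absurd hodd.1 (by decide)
    have hm : 0 < m := hodd.2.pos
    have i1 := ih m (by nlinarith [hp.two_le]) hodd.2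
    have i2 : ((if p ∣ m then (normReps D (m / p)).card else 0 : ℕ) : ℤ) =
        (normReps D 1).card * (if p ∣ m then ∑ d ∈ (m / p).divisors, χ d else 0) := by
      split_ifs with h
      · refine ih _ ?_ (hodd.2.of_dvd_nat (Nat.div_dvd_of_dvd h))
        have := Nat.div_le_self m p
        nlinarith [hp.two_le]
      · simp
    rw [sum_divisors_prime_mul hχ hp hm]
    rcases hprime p hp hp2 with ⟨h, hpD, s, t, hst⟩ | ⟨h, h'⟩ | ⟨h, rfl⟩
    · have h3 := card_normReps_split (m := m) hD hp hp2 hpD hst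
      have h4 : ((normReps D (p * m)).card : ℤ) +
          ((if p ∣ m then (normReps D (m / p)).card else 0 : ℕ) : ℤ) =
          2 * ((normReps D m).card : ℤ) := by exact_mod_cast h3
      rw [i2, i1] at h4
      rw [h]
      linear_combination h4
    · rw [card_normReps_inert hD hp h', i2, h]
      ring
    · rw [card_normReps_ramified hp, i1, h]
      ring

theorem exists_sq_add_three_mul_sq {p : ℕ} (hp : p.Prime) (h : p % 3 = 1) :
    ∃ s t : ℤ, (p : ℤ) = s ^ 2 + 3 * t ^ 2 := by
  have := Fact.mk hp
  have hp2 : p ≠ 2 := by rintro rfl; omega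
  obtain ⟨k, hk⟩ : ∃ k : ZMod p, k ^ 2 = -3 := by
    have := Fact.mk Nat.prime_three
    obtain ⟨w, hw⟩ := exists_prime_orderOf_dvd_card (G := (ZMod p)ˣ) 3 (by
      rw [ZMod.card_units]; omega)
    have h1 : w ^ 3 = 1 := hw ▸ pow_orderOf_eq_one w
    have h2 : (w : ZMod p) ≠ 1 := by
      intro h'
      rw [Units.val_eq_one] at h'
      rw [h', orderOf_one] at hw
      omega
    have h3 : (w : ZMod p) ^ 3 = 1 := by
      simpa using congrArg Units.val h1
    refine ⟨2 * w + 1, mul_left_cancel₀ (sub_ne_zero.2 h2) ?_⟩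
    linear_combination 4 * h3
  set r := Nat.sqrt p with hr
  obtain ⟨q, hq, q', hq', hne, he⟩ := exists_ne_map_eq_of_card_lt_of_maps_to
    (s := range (r + 1) ×ˢ range (r + 1)) (t := (univ : Finset (ZMod p)))
    (f := fun q => (q.1 : ZMod p) - k * q.2) (by
      rw [card_product, card_range, card_univ, ZMod.card]
      exact Nat.lt_succ_sqrt p) (fun _ _ => mem_univ _)
  obtain ⟨a, b⟩ := q
  obtain ⟨a', b'⟩ := q'
  simp only [mem_product, mem_range] at hq hq' he
  set x : ℤ := a - a' with hx
  set y : ℤ := b - b' with hy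
  have hxy : (p : ℤ) ∣ x ^ 2 + 3 * y ^ 2 := by
    rw [← ZMod.intCast_zmod_eq_zero_iff_dvd]
    push_cast [hx, hy]
    linear_combination (a - a' + k * (b - b') : ZMod p) * he + (b - b' : ZMod p) ^ 2 * hk
  have hr2 : r ^ 2 < p := by
    refine lt_of_le_of_ne (Nat.sqrt_le' p) fun h' => ?_
    rw [← h'] at hp
    exact Nat.Prime.not_prime_pow le_rfl hp
  have hx2 : x ^ 2 ≤ (r : ℤ) ^ 2 := sq_le_sq' (by omega) (by omega)
  have hy2 : y ^ 2 ≤ (r : ℤ) ^ 2 := sq_le_sq' (by omega) (by omega)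
  have hpos : 0 < x ^ 2 + 3 * y ^ 2 := by
    rcases eq_or_ne x 0 with h0 | h0
    · rcases eq_or_ne y 0 with h0' | h0'
      · refine absurd ?_ hne
        rw [Prod.mk.injEq]
        omega
      · positivity
    · positivity
  obtain ⟨c, hc⟩ := hxy
  have hr3 : (r : ℤ) ^ 2 < p := by exact_mod_cast hr2
  have hc1 : 0 < c := by nlinarith
  have hc2 : c < 4 := by nlinarith
  obtain rfl | rfl | rfl : c = 1 ∨ c = 2 ∨ c = 3 := by omega
  · exact ⟨x, y, by linarith⟩
  · have hodd : (p : ℤ) % 2 = 1 := by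
      have := hp.eq_two_or_odd
      omega
    have : ∀ z : ℤ, z ^ 2 % 4 = 0 ∨ z ^ 2 % 4 = 1 := fun z => by
      rcases Int.emod_two_eq_zero_or_one z with h | h
      · left
        obtain ⟨w, rfl⟩ := Int.dvd_of_emod_eq_zero h
        ring_nf
        omega
      · right
        exact Int.sq_mod_four_eq_one_of_odd (Int.odd_iff.2 h)
    have h1 := this x
    have h2 := this y
    omega
  · obtain ⟨z, hz⟩ : (3 : ℤ) ∣ x :=
      Int.prime_three.dvd_of_dvd_pow (n := 2) ⟨p - y ^ 2, by linarith⟩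
    rw [hz] at hc
    exact ⟨y, z, by linarith⟩

theorem dvd_of_dvd_sq_add_three_mul_sq {p : ℕ} (hp : p.Prime) (hp2 : p ≠ 2) (h : p % 3 = 2)
    {u v : ℤ} (huv : (p : ℤ) ∣ u ^ 2 + 3 * v ^ 2) : (p : ℤ) ∣ u ∧ (p : ℤ) ∣ v := by
  have := Fact.mk hp
  rw [← ZMod.intCast_zmod_eq_zero_iff_dvd] at huv
  push_cast at huv
  have h2 : (2 : ZMod p) ≠ 0 := by
    intro h'
    have : ((2 : ℕ) : ZMod p) = 0 := by exact_mod_cast h'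
    rw [ZMod.natCast_eq_zero_iff] at this
    exact hp2 ((Nat.prime_dvd_prime_iff_eq hp Nat.prime_two).1 this)
  have h3 : (3 : ZMod p) ≠ 0 := by
    intro h'
    have : ((3 : ℕ) : ZMod p) = 0 := by exact_mod_cast h'
    rw [ZMod.natCast_eq_zero_iff, Nat.prime_dvd_prime_iff_eq hp Nat.prime_three] at this
    omega
  rw [← ZMod.intCast_zmod_eq_zero_iff_dvd, ← ZMod.intCast_zmod_eq_zero_iff_dvd]
  have hv : (v : ZMod p) = 0 := by
    by_contra hv
    set w : ZMod p := (u / v - 1) / 2 with hw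
    have hk : (u / v : ZMod p) ^ 2 = -3 := by
      field_simp
      linear_combination huv
    have hu : (u / v : ZMod p) = 2 * w + 1 := by
      rw [hw]
      field_simp
      ring
    rw [hu] at hk
    have h4 : w ^ 2 + w + 1 = 0 := by
      have : (2 : ZMod p) * 2 * (w ^ 2 + w + 1) = 0 := by linear_combination hk
      exact (mul_eq_zero.1 this).resolve_left (mul_ne_zero h2 h2)
    have h5 : w ^ 3 = 1 := by linear_combination (w - 1) * h4
    have h6 : w ≠ 0 := by
      intro h'
      rw [h'] at h5
      norm_num at h5
    have h7 : w ^ (p - 1) = 1 := ZMod.pow_card_sub_one_eq_one h6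
    rw [show p - 1 = 3 * (p / 3) + 1 by omega, pow_succ, pow_mul, h5, one_pow, one_mul] at h7
    rw [h7] at h4
    refine h3 ?_
    linear_combination h4
  refine ⟨?_, hv⟩
  rw [hv] at huv
  exact pow_eq_zero_iff two_ne_zero |>.1 (by linear_combination huv)

theorem chiNeg3_mul (m k : ℤ) : chiNeg3 (m * k) = chiNeg3 m * chiNeg3 k := by
  have := chi_mul m k
  unfold chi at this
  exact_mod_cast this

theorem card_normReps_three {N : ℕ} (hN : Odd N) :
    ((normReps 3 N).card : ℤ) = 2 * ∑ d ∈ N.divisors, chiNeg3 d := by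
  have h1 : (normReps 3 1).card = 2 := by
    have : normReps 3 1 = {(1, 0), (-1, 0)} := by
      ext ⟨u, v⟩
      rw [mem_normReps (by norm_num)]
      simp only [mem_insert, mem_singleton, Prod.mk.injEq]
      constructor
      · intro h
        push_cast at h
        have hv : v = 0 := by
          have := sq_nonneg u
          have h2 : v ^ 2 < 1 := by linarith
          exact pow_eq_zero_iff (two_ne_zero) |>.1 (le_antisymm (by omega) (sq_nonneg v))
        subst hv
        have hu : u ^ 2 = 1 := by linarith
        rcases (sq_eq_sq_iff_eq_or_eq_neg.1 (hu.trans (one_pow 2).symm)) with h | h <;> simp [h]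
      · rintro (⟨rfl, rfl⟩ | ⟨rfl, rfl⟩) <;> norm_num
    rw [this]; rfl
  have := card_normReps_eq (D := 3) (by norm_num) (χ := fun d => chiNeg3 d) (by rfl)
    (fun a b => by push_cast; exact chiNeg3_mul _ _) ?_ N hN
  · rw [this, h1]; rfl
  · intro p hp hp2
    have : p % 3 = 0 ∨ p % 3 = 1 ∨ p % 3 = 2 := by omega
    rcases this with h | h | h
    · exact .inr (.inr ⟨by simp only [chiNeg3]; split_ifs <;> omega,
        ((Nat.prime_dvd_prime_iff_eq Nat.prime_three hp).1 (Nat.dvd_of_mod_eq_zero h)).symm⟩)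
    · refine .inl ⟨by simp only [chiNeg3]; split_ifs <;> omega, fun h3 => ?_,
        exists_sq_add_three_mul_sq hp h⟩
      have := (Nat.prime_dvd_prime_iff_eq hp Nat.prime_three).1 h3
      subst this
      norm_num at h
    · exact .inr (.inl ⟨by simp only [chiNeg3]; split_ifs <;> omega, fun u v huv =>
        dvd_of_dvd_sq_add_three_mul_sq hp hp2 h huv⟩)

theorem card_normReps_one {N : ℕ} (hN : Odd N) :
    ((normReps 1 N).card : ℤ) = 4 * ∑ d ∈ N.divisors, ZMod.χ₄ d := by
  have h1 : (normReps 1 1).card = 4 := by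
    have : normReps 1 1 = {(1, 0), (-1, 0), (0, 1), (0, -1)} := by
      ext ⟨u, v⟩
      rw [mem_normReps (by norm_num)]
      simp only [mem_insert, mem_singleton, Prod.mk.injEq]
      constructor
      · intro h
        push_cast at h
        have hu : u ≤ 1 ∧ -1 ≤ u := ⟨by nlinarith, by nlinarith⟩
        have hv : v ≤ 1 ∧ -1 ≤ v := ⟨by nlinarith, by nlinarith⟩
        obtain ⟨hu1, hu2⟩ := hu
        obtain ⟨hv1, hv2⟩ := hv
        interval_cases u <;> interval_cases v <;> simp_all
      · rintro (⟨rfl, rfl⟩ | ⟨rfl, rfl⟩ | ⟨rfl, rfl⟩ | ⟨rfl, rfl⟩) <;> norm_num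
    rw [this]; rfl
  have := card_normReps_eq (D := 1) (by norm_num) (χ := fun d => ZMod.χ₄ d) (by simp)
    (fun a b => by push_cast; exact map_mul _ _ _) ?_ N hN
  · rw [this, h1]; rfl
  · intro p hp hp2
    have : Fact p.Prime := ⟨hp⟩
    have hodd := hp.eq_two_or_odd.resolve_left hp2
    have : p % 4 = 1 ∨ p % 4 = 3 := by omega
    rcases this with h | h
    · obtain ⟨s, t, hst⟩ := Nat.Prime.sq_add_sq (p := p) (by omega)
      exact .inl ⟨ZMod.χ₄_nat_one_mod_four h, hp.one_lt.ne' ∘ Nat.dvd_one.1,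
        s, t, by rw [← hst]; push_cast; ring⟩
    · refine .inr (.inl ⟨ZMod.χ₄_nat_three_mod_four h, fun u v huv => ?_⟩)
      have h0 : (u : ZMod p) ^ 2 + (v : ZMod p) ^ 2 = 0 := by
        have := (ZMod.intCast_zmod_eq_zero_iff_dvd _ p).2 huv
        push_cast at this
        simpa using this
      have hv : (v : ZMod p) = 0 := by
        by_contra hv
        exact ZMod.mod_four_ne_three_of_sq_eq_neg_sq' hv (eq_neg_of_add_eq_zero_left h0) h
      have hu : (u : ZMod p) = 0 := by simpa [hv] using h0
      exact ⟨(ZMod.intCast_zmod_eq_zero_iff_dvd _ p).1 hu,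
        (ZMod.intCast_zmod_eq_zero_iff_dvd _ p).1 hv⟩

/-- The triangular numbers. -/
def tri (x : ℕ) : ℕ := x * (x + 1) / 2

theorem eight_mul_tri (x : ℕ) : 8 * (tri x : ℤ) + 1 = (2 * x + 1) ^ 2 := by
  have h : 2 * tri x = x * (x + 1) := Nat.mul_div_cancel' (Nat.even_mul_succ_self x).two_dvd
  zify at h
  linear_combination 4 * h

theorem le_tri (x : ℕ) : x ≤ tri x := by
  have h := eight_mul_tri x
  zify
  rcases Nat.eq_zero_or_pos x with rfl | hx
  · simp
  · have : (1 : ℤ) ≤ x := by exact_mod_cast hx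
    nlinarith

/-- The pairs of natural numbers with `tri x + c * tri y = k`. -/
def triPairs (c k : ℕ) : Finset (ℕ × ℕ) :=
  (range (k + 1) ×ˢ range (k + 1)).filter fun p => tri p.1 + c * tri p.2 = k

theorem mem_triPairs {c k : ℕ} (hc : 0 < c) {x y : ℕ} :
    (x, y) ∈ triPairs c k ↔ tri x + c * tri y = k := by
  simp only [triPairs, mem_filter, mem_product, mem_range, and_iff_right_iff_imp]
  intro h
  have h1 := le_tri x
  have h2 := le_tri y
  have h3 := Nat.le_mul_of_pos_left (tri y) hc
  omega

theorem card_normReps_filter_odd {c : ℕ} (hc : 0 < c) (k : ℕ) :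
    ((normReps c (8 * k + 1 + c)).filter fun w => Odd w.1 ∧ Odd w.2).card =
      4 * (triPairs c k).card := by
  have : 4 * (triPairs c k).card =
      (triPairs c k ×ˢ ({1, -1} : Finset ℤ) ×ˢ ({1, -1} : Finset ℤ)).card := by
    rw [card_product, mul_comm]; rfl
  rw [this]
  symm
  refine card_bij (fun q _ => (q.2.1 * (2 * q.1.1 + 1), q.2.2 * (2 * q.1.2 + 1))) ?_ ?_ ?_
  · rintro ⟨⟨x, y⟩, s, t⟩ h
    simp only [mem_product, mem_triPairs hc, mem_insert, mem_singleton] at h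
    obtain ⟨h, hs, ht⟩ := h
    simp only [mem_filter, mem_normReps hc]
    have hs2 : s ^ 2 = 1 := by rcases hs with rfl | rfl <;> rfl
    have ht2 : t ^ 2 = 1 := by rcases ht with rfl | rfl <;> rfl
    refine ⟨?_, ?_, ?_⟩
    · have hx := eight_mul_tri x
      have hy := eight_mul_tri y
      zify at h
      push_cast
      rw [mul_pow, mul_pow, hs2, ht2]
      linear_combination 8 * h - hx - c * hy
    · rcases hs with rfl | rfl <;> rw [Int.odd_iff] <;> omega
    · rcases ht with rfl | rfl <;> rw [Int.odd_iff] <;> omega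
  · rintro ⟨⟨x, y⟩, s, t⟩ h ⟨⟨x', y'⟩, s', t'⟩ h' e
    simp only [mem_product, mem_insert, mem_singleton] at h h'
    obtain ⟨-, hs, ht⟩ := h
    obtain ⟨-, hs', ht'⟩ := h'
    simp only [Prod.mk.injEq] at e ⊢
    obtain ⟨e1, e2⟩ := e
    have h1 : x = x' ∧ s = s' := by
      rcases hs with rfl | rfl <;> rcases hs' with rfl | rfl <;> omega
    have h2 : y = y' ∧ t = t' := by
      rcases ht with rfl | rfl <;> rcases ht' with rfl | rfl <;> omega
    exact ⟨⟨h1.1, h2.1⟩, h1.2, h2.2⟩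
  · have key : ∀ X : ℤ, Odd X → ∃ (x : ℕ) (s : ℤ), (s = 1 ∨ s = -1) ∧ s * (2 * x + 1) = X := by
      rintro X ⟨m, rfl⟩
      rcases le_or_gt 0 m with hm | hm
      · lift m to ℕ using hm
        exact ⟨m, 1, .inl rfl, one_mul _⟩
      · obtain ⟨j, hj⟩ := Int.eq_ofNat_of_zero_le (a := -m - 1) (by omega)
        exact ⟨j, -1, .inr rfl, by omega⟩
    rintro ⟨X, Y⟩ h
    simp only [mem_filter, mem_normReps hc] at h
    obtain ⟨h, hX, hY⟩ := h
    obtain ⟨x, s, hs, rfl⟩ := key X hX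
    obtain ⟨y, t, ht, rfl⟩ := key Y hY
    refine ⟨((x, y), s, t), ?_, rfl⟩
    simp only [mem_product, mem_triPairs hc, mem_insert, mem_singleton]
    refine ⟨?_, hs, ht⟩
    have hs2 : s ^ 2 = 1 := by rcases hs with rfl | rfl <;> rfl
    have ht2 : t ^ 2 = 1 := by rcases ht with rfl | rfl <;> rfl
    rw [mul_pow, mul_pow, hs2, ht2] at h
    push_cast at h
    have hx := eight_mul_tri x
    have hy := eight_mul_tri y
    have : 8 * ((tri x : ℤ) + c * tri y) = 8 * k := by linear_combination h + hx + c * hy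
    zify
    linarith

theorem card_triPairs_one (k : ℕ) :
    ((triPairs 1 k).card : ℤ) = ∑ d ∈ (4 * k + 1).divisors, ZMod.χ₄ d := by
  have h1 := card_normReps_filter_odd (c := 1) one_pos k
  have h2 := card_normReps_one (N := 4 * k + 1) ⟨2 * k, by ring⟩
  have h3 : (normReps 1 (4 * k + 1)).card =
      ((normReps 1 (8 * k + 1 + 1)).filter fun w => Odd w.1 ∧ Odd w.2).card := by
    refine card_bij (fun w _ => (w.1 + w.2, w.1 - w.2)) ?_ ?_ ?_
    · rintro ⟨u, v⟩ h
      simp only [mem_filter, mem_normReps one_pos] at h ⊢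
      push_cast at h ⊢
      have : Odd (u ^ 2 + v ^ 2) := ⟨2 * k, by linarith⟩
      refine ⟨by linear_combination 2 * h, ?_, ?_⟩ <;>
        simpa [parity_simps] using this
    · rintro ⟨u, v⟩ - ⟨u', v'⟩ - h
      simp only [Prod.mk.injEq] at h ⊢
      omega
    · rintro ⟨X, Y⟩ h
      simp only [mem_filter, mem_normReps one_pos] at h
      obtain ⟨h, ⟨m, rfl⟩, ⟨n, rfl⟩⟩ := h
      refine ⟨(m + n + 1, m - n), ?_, by simp only [Prod.mk.injEq]; omega⟩
      rw [mem_normReps one_pos]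
      push_cast at h ⊢
      linarith
  omega

theorem card_triPairs_three (k : ℕ) :
    ((triPairs 3 k).card : ℤ) = ∑ d ∈ (2 * k + 1).divisors, chiNeg3 d := by
  have h1 := card_normReps_filter_odd (c := 3) three_pos k
  have h2 := card_normReps_three (N := 2 * k + 1) ⟨k, by ring⟩
  have h3 : 2 * (normReps 3 (2 * k + 1)).card =
      ((normReps 3 (8 * k + 1 + 3)).filter fun w => Odd w.1 ∧ Odd w.2).card := by
    have : 2 * (normReps 3 (2 * k + 1)).card =
        (normReps 3 (2 * k + 1) ×ˢ ({1, -1} : Finset ℤ)).card := by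
      rw [card_product, mul_comm]; rfl
    rw [this]
    have par : ∀ u v : ℤ, u ^ 2 + (3 : ℕ) * v ^ 2 = (2 * k + 1 : ℕ) → Odd (u + v) := by
      intro u v h
      push_cast at h
      have : Odd (u ^ 2 + 3 * v ^ 2) := ⟨k, h⟩
      simpa [parity_simps, show ¬ Even (3 : ℤ) by decide] using this
    refine card_bij (fun w _ => (w.1.1 - 3 * w.1.2, w.2 * (w.1.1 + w.1.2))) ?_ ?_ ?_
    · rintro ⟨⟨u, v⟩, s⟩ h
      simp only [mem_filter, mem_product, mem_normReps three_pos, mem_insert, mem_singleton] at h ⊢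
      obtain ⟨h, hs⟩ := h
      obtain ⟨j, hj⟩ := par u v h
      have hs2 : s ^ 2 = 1 := by rcases hs with rfl | rfl <;> rfl
      refine ⟨?_, ⟨j - 2 * v, by omega⟩, ?_⟩
      · rw [mul_pow, hs2]
        push_cast at h ⊢
        linear_combination 4 * h
      · rcases hs with rfl | rfl <;> rw [Int.odd_iff] <;> omega
    · rintro ⟨⟨u, v⟩, s⟩ h ⟨⟨u', v'⟩, s'⟩ h' e
      simp only [mem_product, mem_normReps three_pos, mem_insert, mem_singleton] at h h'
      obtain ⟨j, hj⟩ := par u v h.1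
      obtain ⟨j', hj'⟩ := par u' v' h'.1
      simp only [Prod.mk.injEq] at e ⊢
      rcases h.2 with rfl | rfl <;> rcases h'.2 with rfl | rfl <;> omega
    · rintro ⟨X, Y⟩ h
      simp only [mem_filter, mem_normReps three_pos] at h
      obtain ⟨h, hX, hY⟩ := h
      have : ∃ s v : ℤ, (s = 1 ∨ s = -1) ∧ s * Y = X + 4 * v := by
        rw [Int.odd_iff] at hX hY
        have : 4 ∣ Y - X ∨ 4 ∣ -Y - X := by omega
        rcases this with ⟨v, hv⟩ | ⟨v, hv⟩
        · exact ⟨1, v, .inl rfl, by omega⟩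
        · exact ⟨-1, v, .inr rfl, by omega⟩
      obtain ⟨s, v, hs, hv⟩ := this
      have hs2 : s * s = 1 := by rcases hs with rfl | rfl <;> rfl
      obtain rfl : Y = s * (X + 4 * v) := by rw [← hv, ← mul_assoc, hs2, one_mul]
      refine ⟨((X + 3 * v, v), s), ?_, by simp only [Prod.mk.injEq]; constructor <;> ring⟩
      simp only [mem_product, mem_normReps three_pos, mem_insert, mem_singleton]
      refine ⟨?_, hs⟩
      push_cast at h ⊢
      rw [mul_pow, pow_two s, hs2] at h
      linarith
  omega

/-- The potential for sums of `χ₄ a * χ₄ b` over odd solutions; `x` and `y` matter modulo two. -/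
def chiFourPot (a b : ZMod 4) (x y : ZMod 2) : ℤ :=
  -(ZMod.χ₄ a * ZMod.χ₄ b * (x.val * y.val)) +
    (ZMod.χ₄ (a + 1) * ZMod.χ₄ b ^ 2 * (x.val * (1 - y.val)) +
      ZMod.χ₄ (b + 1) * ZMod.χ₄ a ^ 2 * ((1 - x.val) * y.val))

theorem chiFourPot_swap : ∀ (a b : ZMod 4) (x y : ZMod 2),
    chiFourPot b a y x = chiFourPot a b x y := by
  unfold chiFourPot; decide

theorem chiFourPot_shear : ∀ (a b : ZMod 4) (x y : ZMod 2),
    chiFourPot (a - b) b x (x + y) - chiFourPot a b x y =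
      ZMod.χ₄ a * ZMod.χ₄ b * (x.val * y.val) + ZMod.χ₄ b * ZMod.χ₄ a * (y.val * x.val) := by
  unfold chiFourPot; decide

theorem chiFourPot_zero : ∀ (b : ZMod 4) (x y : ZMod 2),
    chiFourPot 0 b x y = ZMod.χ₄ b ^ 2 * (x.val * (1 - y.val)) := by
  unfold chiFourPot; decide

theorem chiFourPot_diag : ∀ (a b : ZMod 4) (x : ZMod 2),
    chiFourPot a b x x = -(ZMod.χ₄ a * ZMod.χ₄ b * x.val) := by
  unfold chiFourPot; decide

theorem chiFour_mul_two_sub : ∀ a : ZMod 4,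
    ZMod.χ₄ a * ZMod.χ₄ (2 - a) = ZMod.χ₄ a ^ 2 := by
  decide

theorem val_intCast_two (x : ℤ) : ((x : ZMod 2).val : ℤ) = if Odd x then 1 else 0 := by
  by_cases h : Odd x
  · rw [ZMod.intCast_eq_one_iff_odd.2 h, if_pos h]; rfl
  · rw [ZMod.intCast_eq_zero_iff_even.2 (Int.not_odd_iff_even.1 h), if_neg h]; rfl

theorem chiFour_sq (b : ℤ) : ZMod.χ₄ (b : ZMod 4) ^ 2 = if Odd b then 1 else 0 := by
  simp only [ZMod.χ₄_int_eq_if_mod_four, Int.odd_iff]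
  split_ifs <;> first | rfl | omega

theorem chiFour_eq_ite (b : ℤ) :
    ZMod.χ₄ (b : ZMod 4) = if Odd b then ZMod.χ₄ (b : ZMod 4) else 0 := by
  simp only [ZMod.χ₄_int_eq_if_mod_four, Int.odd_iff]
  split_ifs <;> first | rfl | omega

theorem quadSum_chiFour {N : ℕ} (hN : Odd N) :
    quadSum (2 * N) (fun a b x y => if Odd a ∧ Odd b ∧ Odd x ∧ Odd y then
      (ZMod.χ₄ a * ZMod.χ₄ b : ℤ) else 0) = ∑ d ∈ N.divisors, (d : ℚ) := by
  have h := two_mul_quadSum (N := 2 * N) (fun a b x y => (chiFourPot a b x y : ℚ))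
    (fun a b x y => ((ZMod.χ₄ a * ZMod.χ₄ b * ((x : ZMod 2).val * (y : ZMod 2).val) : ℤ) : ℚ))
    (fun a b x y => by rw [chiFourPot_swap])
    (fun a b x y => by
      have := chiFourPot_shear a b x y
      push_cast
      exact_mod_cast this)
  have h1 : quadSum (2 * N) (fun a b x y => if Odd a ∧ Odd b ∧ Odd x ∧ Odd y then
      (ZMod.χ₄ a * ZMod.χ₄ b : ℤ) else 0) = quadSum (2 * N) (fun a b x y =>
        ((ZMod.χ₄ a * ZMod.χ₄ b * ((x : ZMod 2).val * (y : ZMod 2).val) : ℤ) : ℚ)) := by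
    refine quadSum_congr fun a b x y _ _ _ _ _ => ?_
    rw [val_intCast_two, val_intCast_two, chiFour_eq_ite a, chiFour_eq_ite b]
    by_cases ha : Odd a <;> by_cases hb : Odd b <;> by_cases hx : Odd x <;>
      by_cases hy : Odd y <;> simp [ha, hb, hx, hy]
  have hs : ∑ d ∈ N.divisors, ((N / d : ℕ) : ℚ) = ∑ d ∈ N.divisors, (d : ℚ) :=
    Nat.sum_div_divisors N fun d => (d : ℚ)
  have hdiv : ∀ (d m : ℕ), 0 < d → 2 * (d * m) / d = 2 * m := fun d m hd => by
    rw [show 2 * (d * m) = d * (2 * m) by ring, Nat.mul_div_cancel_left _ hd]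
  have h2 : quadSum (2 * N) (fun a b x y =>
      if a = b then (chiFourPot (0 : ℤ) b x ((x + y : ℤ) : ZMod 2) : ℚ) else 0) =
      ∑ d ∈ N.divisors, (d : ℚ) := by
    rw [quadSum_diag_left (2 * N) (fun _ b x y =>
      (chiFourPot (0 : ℤ) b x ((x + y : ℤ) : ZMod 2) : ℚ))]
    have e : ∀ d ∈ (2 * N).divisors, ∑ x ∈ Ico 1 (2 * N / d),
        (chiFourPot (0 : ℤ) ((d : ℤ) : ZMod 4) ((x : ℤ) : ZMod 2)
          (((x : ℤ) + (((2 * N / d : ℕ) : ℤ) - x) : ℤ) : ZMod 2) : ℚ) =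
        if Odd (d : ℤ) then ((N / d : ℕ) : ℚ) else 0 := by
      intro d hd
      simp only [add_sub_cancel, Int.cast_zero, chiFourPot_zero, chiFour_sq, val_intCast_two]
      by_cases hdo : Odd (d : ℤ)
      · simp only [if_pos hdo]
        have : d ∣ N :=
          (Nat.coprime_two_right.2 (by exact_mod_cast hdo)).dvd_of_dvd_mul_left
            (Nat.dvd_of_mem_divisors hd)
        obtain ⟨m, rfl⟩ := this
        have hd0 := Nat.pos_of_mem_divisors hd
        rw [hdiv d m hd0, Nat.mul_div_cancel_left _ hd0]
        have e : ∀ x : ℕ, (((1 : ℤ) * ((if Odd (x : ℤ) then 1 else 0) *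
            (1 - if Odd ((2 * m : ℕ) : ℤ) then 1 else 0)) : ℤ) : ℚ) =
            if Odd (x : ℤ) then 1 else 0 := fun x => by
          rw [if_neg (show ¬ Odd ((2 * m : ℕ) : ℤ) by simp [parity_simps])]
          split_ifs <;> norm_num
        rw [sum_congr rfl fun x _ => e x, sum_Ico_ite_odd (fun _ => 1)]
        simp
      · simp [hdo]
    rw [sum_congr rfl e]
    have e2 := sum_divisors_two_mul (n := N)
      (fun d => if Odd (d : ℤ) then ((N / d : ℕ) : ℚ) else 0) (fun d hd => if_neg (by
        rw [Int.not_odd_iff_even]; exact_mod_cast hd))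
    rw [e2, ← hs]
    refine sum_congr rfl fun d hd => if_pos ?_
    exact_mod_cast hN.of_dvd_nat (Nat.dvd_of_mem_divisors hd)
  have h3 : quadSum (2 * N) (fun a b x y =>
      if x = y then (chiFourPot a b x y : ℚ) else 0) = -∑ d ∈ N.divisors, (d : ℚ) := by
    rw [quadSum_diag_right, ← hs, ← sum_neg_distrib, sum_divisors_two_mul]
    · refine sum_congr rfl fun d hd => ?_
      have hd0 := Nat.pos_of_mem_divisors hd
      have hdN := Nat.dvd_of_mem_divisors hd
      obtain ⟨m, rfl⟩ := hdN
      have hodd := Nat.odd_mul.1 hN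
      have hdo : Odd (d : ℤ) := by exact_mod_cast hodd.1
      obtain ⟨j, hj⟩ := hodd.2
      have e : ∀ a : ℕ, (chiFourPot ((a : ℤ) : ZMod 4) (((2 * m : ℕ) - (a : ℤ) : ℤ) : ZMod 4)
          ((d : ℤ) : ZMod 2) ((d : ℤ) : ZMod 2) : ℚ) = if Odd (a : ℤ) then -1 else 0 := by
        intro a
        have : (((2 * m : ℕ) - (a : ℤ) : ℤ) : ZMod 4) = 2 - ((a : ℤ) : ZMod 4) := by
          rw [hj]
          push_cast
          have : (4 : ZMod 4) = 0 := rfl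
          linear_combination (j : ZMod 4) * this
        rw [chiFourPot_diag, this, chiFour_mul_two_sub, chiFour_sq, val_intCast_two, if_pos hdo]
        split_ifs <;> norm_num
      rw [hdiv d m hd0, Nat.mul_div_cancel_left _ hd0, sum_congr rfl fun a _ => e a,
        sum_Ico_ite_odd (fun _ => -1)]
      simp
    · intro d hd
      refine sum_eq_zero fun a _ => ?_
      rw [chiFourPot_diag, val_intCast_two, if_neg (by
        rw [Int.not_odd_iff_even]; exact_mod_cast hd)]
      simp
  rw [h1]
  push_cast at h h2 h3 ⊢
  rw [h2, h3] at h
  linarith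

theorem sum_divisors_chiFour_eq_zero {N : ℕ} (hN : N % 4 = 3) :
    ∑ d ∈ N.divisors, ZMod.χ₄ d = 0 := by
  have h : normReps 1 N = ∅ := by
    refine eq_empty_of_forall_notMem ?_
    rintro ⟨u, v⟩ h
    rw [mem_normReps one_pos] at h
    have key : ∀ w : ℤ, w ^ 2 % 4 = 0 ∨ w ^ 2 % 4 = 1 := by
      intro w
      rcases Int.even_or_odd w with hw | hw
      · exact .inl (Int.emod_eq_zero_of_dvd (by simpa using pow_dvd_pow_of_dvd hw.two_dvd 2))
      · exact .inr (Int.sq_mod_four_eq_one_of_odd hw)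
    have h1 := key u
    have h2 := key v
    push_cast at h
    omega
  have := card_normReps_one (N := N) (Nat.odd_iff.2 (by omega))
  rw [h, card_empty] at this
  push_cast at this
  linarith

theorem quadSum_odd_mul (M : ℕ) (f g : ℤ → ℚ) :
    quadSum M (fun a b x y => if Odd a ∧ Odd b ∧ Odd x ∧ Odd y then f a * g b else 0) =
      ∑ p ∈ antidiagonal M, if Odd p.1 ∧ Odd p.2 then
        (∑ d ∈ p.1.divisors, f d) * ∑ d ∈ p.2.divisors, g d else 0 := by
  unfold quadSum
  rw [← sum_filter, ← sum_filter]
  simp only [sum_mul_sum, ← sum_product']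
  rw [sum_sigma']
  refine sum_bij' (fun q _ => ⟨(q.1 * q.2.2.1, q.2.1 * q.2.2.2), q.1, q.2.1⟩)
    (fun s _ => (s.2.1, s.2.2, s.1.1 / s.2.1, s.1.2 / s.2.2)) ?_ ?_ ?_ ?_ ?_
  · rintro ⟨a, b, x, y⟩ h
    simp only [mem_filter, mem_quads, Int.odd_coe_nat] at h
    obtain ⟨⟨ha, hb, hx, hy, e⟩, ha', hb', hx', hy'⟩ := h
    simp only [mem_sigma, mem_filter, HasAntidiagonal.mem_antidiagonal, mem_product,
      Nat.mem_divisors]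
    exact ⟨⟨e, ha'.mul hx', hb'.mul hy'⟩, ⟨dvd_mul_right _ _, by positivity⟩,
      dvd_mul_right _ _, by positivity⟩
  · rintro ⟨⟨u, v⟩, a, b⟩ h
    simp only [mem_sigma, mem_filter, HasAntidiagonal.mem_antidiagonal, mem_product,
      Nat.mem_divisors] at h
    obtain ⟨⟨e, hu, hv⟩, ⟨⟨x, rfl⟩, hu0⟩, ⟨y, rfl⟩, hv0⟩ := h
    obtain ⟨ha, hx⟩ := Nat.odd_mul.1 hu
    obtain ⟨hb, hy⟩ := Nat.odd_mul.1 hv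
    simp only [mem_filter, mem_quads, Int.odd_coe_nat, Nat.mul_div_cancel_left _ ha.pos,
      Nat.mul_div_cancel_left _ hb.pos]
    exact ⟨⟨ha.pos, hb.pos, hx.pos, hy.pos, e⟩, ha, hb, hx, hy⟩
  · rintro ⟨a, b, x, y⟩ h
    simp only [mem_filter, mem_quads] at h
    simp [Nat.mul_div_cancel_left _ h.1.1, Nat.mul_div_cancel_left _ h.1.2.1]
  · rintro ⟨⟨u, v⟩, a, b⟩ h
    simp only [mem_sigma, mem_filter, mem_product, Nat.mem_divisors] at h
    simp [Nat.mul_div_cancel' h.2.1.1, Nat.mul_div_cancel' h.2.2.1]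
  · rintro ⟨a, b, x, y⟩ h
    rfl

theorem sum_antidiagonal_odd (n : ℕ) (h : ℕ → ℕ → ℚ) :
    ∑ p ∈ antidiagonal (2 * (n + 1)), (if Odd p.1 ∧ Odd p.2 then h p.1 p.2 else 0) =
      ∑ p ∈ antidiagonal n, h (2 * p.1 + 1) (2 * p.2 + 1) := by
  rw [← sum_filter]
  symm
  refine sum_bij (fun p _ => (2 * p.1 + 1, 2 * p.2 + 1)) ?_ ?_ ?_ ?_
  · rintro ⟨i, j⟩ hp
    simp only [mem_filter, HasAntidiagonal.mem_antidiagonal] at hp ⊢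
    exact ⟨by omega, ⟨i, rfl⟩, ⟨j, rfl⟩⟩
  · rintro ⟨i, j⟩ - ⟨i', j'⟩ - e
    simpa using e
  · rintro ⟨u, v⟩ hp
    simp only [mem_filter, HasAntidiagonal.mem_antidiagonal] at hp
    obtain ⟨e, ⟨i, rfl⟩, ⟨j, rfl⟩⟩ := hp
    exact ⟨(i, j), by simp only [HasAntidiagonal.mem_antidiagonal]; omega, rfl⟩
  · intros; rfl

theorem sum_antidiagonal_even (n : ℕ) (h : ℕ → ℕ → ℚ) (h0 : ∀ i j, Odd i → h i j = 0) :
    ∑ p ∈ antidiagonal (2 * n), h p.1 p.2 = ∑ p ∈ antidiagonal n, h (2 * p.1) (2 * p.2) := by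
  have e : ∑ p ∈ antidiagonal (2 * n), h p.1 p.2 =
      ∑ p ∈ (antidiagonal (2 * n)).filter (fun p => Even p.1), h p.1 p.2 := by
    rw [sum_filter]
    refine sum_congr rfl fun p _ => ?_
    split_ifs with hp
    · rfl
    · exact h0 _ _ (Nat.not_even_iff_odd.1 hp)
  rw [e]
  symm
  refine sum_bij (fun p _ => (2 * p.1, 2 * p.2)) ?_ ?_ ?_ ?_
  · rintro ⟨i, j⟩ hp
    simp only [mem_filter, HasAntidiagonal.mem_antidiagonal] at hp ⊢
    exact ⟨by omega, by simp⟩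
  · rintro ⟨i, j⟩ - ⟨i', j'⟩ - e
    simpa using e
  · rintro ⟨u, v⟩ hp
    simp only [mem_filter, HasAntidiagonal.mem_antidiagonal] at hp
    obtain ⟨e, i, rfl⟩ := hp
    exact ⟨(i, n - i), by simp only [HasAntidiagonal.mem_antidiagonal]; omega,
      by simp only [Prod.mk.injEq]; omega⟩
  · intros; rfl

/-- The number of representations by four triangular numbers. -/
theorem sum_card_triPairs_one (k : ℕ) :
    ∑ p ∈ antidiagonal k, ((triPairs 1 p.1).card * (triPairs 1 p.2).card : ℚ) =
      ∑ d ∈ (2 * k + 1).divisors, (d : ℚ) := by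
  have hc : ∀ k, ((triPairs 1 k).card : ℚ) =
      ∑ d ∈ (4 * k + 1).divisors, ((ZMod.χ₄ ((d : ℤ) : ZMod 4) : ℤ) : ℚ) := fun k => by
    have := card_triPairs_one k
    simp only [Int.cast_natCast]
    exact_mod_cast this
  rw [← quadSum_chiFour (N := 2 * k + 1) ⟨k, rfl⟩]
  have := quadSum_odd_mul (2 * (2 * k + 1)) (fun a => ((ZMod.χ₄ (a : ZMod 4) : ℤ) : ℚ))
    (fun a => ((ZMod.χ₄ (a : ZMod 4) : ℤ) : ℚ))
  simp only [← Int.cast_mul] at this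
  rw [this, sum_antidiagonal_odd (2 * k) (fun u v =>
    (∑ d ∈ u.divisors, ((ZMod.χ₄ ((d : ℤ) : ZMod 4) : ℤ) : ℚ)) *
      ∑ d ∈ v.divisors, ((ZMod.χ₄ ((d : ℤ) : ZMod 4) : ℤ) : ℚ)),
    sum_antidiagonal_even k (fun i j =>
    (∑ d ∈ (2 * i + 1).divisors, ((ZMod.χ₄ ((d : ℤ) : ZMod 4) : ℤ) : ℚ)) *
      ∑ d ∈ (2 * j + 1).divisors, ((ZMod.χ₄ ((d : ℤ) : ZMod 4) : ℤ) : ℚ))]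
  · refine sum_congr rfl fun p _ => ?_
    simp only [hc, ← mul_assoc, Nat.reduceMul]
  · rintro i j ⟨m, rfl⟩
    have := sum_divisors_chiFour_eq_zero (N := 2 * (2 * m + 1) + 1) (by omega)
    simp only [Int.cast_natCast]
    rw [← Int.cast_sum, this, Int.cast_zero, zero_mul]

theorem deltaRep_eq_sum (k : ℕ) :
    deltaRep 6 ![1, 1, 1, 1, 1, 3] k = ∑ p ∈ antidiagonal k,
      (∑ q ∈ antidiagonal p.1, (triPairs 1 q.1).card * (triPairs 1 q.2).card) *
        (triPairs 3 p.2).card := by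
  let s : Finset ((_ : ℕ × ℕ) × ((_ : ℕ × ℕ) × ((ℕ × ℕ) × (ℕ × ℕ))) × (ℕ × ℕ)) :=
    (antidiagonal k).sigma fun p =>
      ((antidiagonal p.1).sigma fun q => triPairs 1 q.1 ×ˢ triPairs 1 q.2) ×ˢ triPairs 3 p.2
  have hs : s.card = ∑ p ∈ antidiagonal k,
      (∑ q ∈ antidiagonal p.1, (triPairs 1 q.1).card * (triPairs 1 q.2).card) *
        (triPairs 3 p.2).card := by
    simp only [s, card_sigma, card_product]
  let F : ((_ : ℕ × ℕ) × ((_ : ℕ × ℕ) × ((ℕ × ℕ) × (ℕ × ℕ))) × (ℕ × ℕ)) → Fin 6 → ℕ := fun z =>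
    ![z.2.1.2.1.1, z.2.1.2.1.2, z.2.1.2.2.1, z.2.1.2.2.2, z.2.2.1, z.2.2.2]
  have hmem : ∀ a b c d x₁ x₂ x₃ x₄ x₅ x₆ : ℕ,
      (⟨(a, b), ⟨(c, d), (x₁, x₂), (x₃, x₄)⟩, (x₅, x₆)⟩ :
        (_ : ℕ × ℕ) × ((_ : ℕ × ℕ) × ((ℕ × ℕ) × (ℕ × ℕ))) × (ℕ × ℕ)) ∈ s ↔
      a + b = k ∧ c + d = a ∧ tri x₁ + tri x₂ = c ∧ tri x₃ + tri x₄ = d ∧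
        tri x₅ + 3 * tri x₆ = b := by
    intros
    simp only [s, mem_sigma, mem_product, mem_triPairs one_pos, mem_triPairs three_pos,
      HasAntidiagonal.mem_antidiagonal, one_mul]
    tauto
  rw [← hs, ← Set.ncard_coe_finset s, ← Set.InjOn.ncard_image (f := F)]
  · unfold deltaRep
    congr 1
    ext x
    simp only [Set.mem_ofPred_eq, Set.mem_image, mem_coe, Fin.sum_univ_six]
    change k = 1 * tri (x 0) + 1 * tri (x 1) + 1 * tri (x 2) + 1 * tri (x 3) + 1 * tri (x 4) +
      3 * tri (x 5) ↔ _
    constructor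
    · intro h
      refine ⟨⟨(_, _), ⟨(_, _), (x 0, x 1), (x 2, x 3)⟩, (x 4, x 5)⟩,
        (hmem _ _ _ _ _ _ _ _ _ _).2 ⟨?_, rfl, rfl, rfl, rfl⟩, ?_⟩
      · omega
      · ext i; fin_cases i <;> rfl
    · rintro ⟨⟨⟨a, b⟩, ⟨⟨c, d⟩, ⟨x₁, x₂⟩, ⟨x₃, x₄⟩⟩, ⟨x₅, x₆⟩⟩, h, rfl⟩
      have := (hmem _ _ _ _ _ _ _ _ _ _).1 h
      change k = 1 * tri x₁ + 1 * tri x₂ + 1 * tri x₃ + 1 * tri x₄ + 1 * tri x₅ + 3 * tri x₆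
      omega
  · rintro ⟨⟨a, b⟩, ⟨⟨c, d⟩, ⟨x₁, x₂⟩, ⟨x₃, x₄⟩⟩, ⟨x₅, x₆⟩⟩ h
      ⟨⟨a', b'⟩, ⟨⟨c', d'⟩, ⟨y₁, y₂⟩, ⟨y₃, y₄⟩⟩, ⟨y₅, y₆⟩⟩ h' e
    obtain ⟨h1, h2, h3, h4, h5⟩ := (hmem _ _ _ _ _ _ _ _ _ _).1 h
    obtain ⟨h1', h2', h3', h4', h5'⟩ := (hmem _ _ _ _ _ _ _ _ _ _).1 h'
    obtain ⟨rfl, rfl, rfl, rfl, rfl, rfl⟩ :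
        x₁ = y₁ ∧ x₂ = y₂ ∧ x₃ = y₃ ∧ x₄ = y₄ ∧ x₅ = y₅ ∧ x₆ = y₆ :=
      ⟨congrFun e 0, congrFun e 1, congrFun e 2, congrFun e 3, congrFun e 4, congrFun e 5⟩
    subst h3 h4 h5 h3' h4' h5' h2 h2'
    rfl

theorem deltaRep_eq_quadSum (k : ℕ) :
    (deltaRep 6 ![1, 1, 1, 1, 1, 3] k : ℚ) = quadSum (2 * (k + 1))
      (fun a b x y => if Odd a ∧ Odd b ∧ Odd x ∧ Odd y then a * chi b else 0) := by
  rw [quadSum_odd_mul (2 * (k + 1)) (fun a => a) chi,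
    sum_antidiagonal_odd k (fun u v => (∑ d ∈ u.divisors, (((d : ℕ) : ℤ) : ℚ)) *
      ∑ d ∈ v.divisors, chi d), deltaRep_eq_sum]
  push_cast
  refine sum_congr rfl fun p _ => ?_
  rw [sum_card_triPairs_one]
  congr 1
  have := card_triPairs_three p.2
  simp only [chi]
  exact_mod_cast this

theorem delta_111113_formula (n : ℕ) (hn : 1 ≤ n)
    (A B : ℕ → ℤ)
    (hA : ∀ m : ℕ, A m = ∑ d ∈ m.divisors, chiNeg3 (d : ℤ) * (d : ℤ) ^ 2)
    (hB : ∀ m : ℕ, B m = ∑ d ∈ m.divisors, chiNeg3 ((m / d : ℕ) : ℤ) * (d : ℤ) ^ 2) :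
    (deltaRep 6 ![1, 1, 1, 1, 1, 3] (n - 1) : ℚ) =
      -(1 / 8) * (A n : ℚ) + (1 / 8) * (if 2 ∣ n then (A (n / 2) : ℚ) else 0) +
        (9 / 8) * (B n : ℚ) + (9 / 8) * (if 2 ∣ n then (B (n / 2) : ℚ) else 0) := by
  rw [deltaRep_eq_quadSum, Nat.sub_add_cancel hn, quadSum_odd_eq,
    sum_divisorsAntidiagonal_odd hn hA hB]
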